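/- There exist real constants a > 0, b > 0, and x₀ > 0 such that for every real x ≥ x₀ one has a·√(x·ln x) ≤ r(x) ≤ b·√(x·ln x); that is, the number r(x) of distinct non-trivial Ramsey numbers in the interval [0, x] has order of magnitude Θ(√(x·ln x)). -/

import Mathlib

open SimpleGraph Finset Real

/-- `ramsey k n` is the least positive integer `N` such that every red/blue coloring of the
edges of the complete graph on `N` vertices (encoded as a simple graph `G` on `Fin N`,
with red edges the edges of `G` and blue edges those of `Gᶜ`) contains a red clique on
`k` vertices or a blue clique on `n` vertices. -/
noncomputable def ramsey (k n : ℕ) : ℕ :=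
  sInf {N : ℕ | 0 < N ∧ ∀ G : SimpleGraph (Fin N),
    (∃ s : Finset (Fin N), G.IsNClique k s) ∨ (∃ s : Finset (Fin N), Gᶜ.IsNClique n s)}

/-- The set `R(x)` of non-trivial Ramsey numbers at most `x`. -/
def RamseySet (x : ℝ) : Set ℕ :=
  {m : ℕ | (∃ k n : ℕ, 3 ≤ k ∧ k ≤ n ∧ ramsey k n = m) ∧ (m : ℝ) ≤ x}

/-- `r(x)`: the number of distinct non-trivial Ramsey numbers in `[0, x]`. -/
noncomputable def ramseyCount (x : ℝ) : ℕ := (RamseySet x).ncard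

/-- The set `R_k(x) = {r(k,n) : n ≥ k} ∩ [0,x]`. -/
def RamseySetRow (k : ℕ) (x : ℝ) : Set ℕ :=
  {m : ℕ | (∃ n : ℕ, k ≤ n ∧ ramsey k n = m) ∧ (m : ℝ) ≤ x}

/-- `r_k(x)`: the number of distinct values `r(k,n)` (`n ≥ k`) in `[0, x]`. -/
noncomputable def ramseyCountRow (k : ℕ) (x : ℝ) : ℕ := (RamseySetRow k x).ncard

/-- The weight of `F` when every element of `α` is kept independently with probability `p`. -/
noncomputable def bernoulliWeight {α : Type*} [Fintype α] [DecidableEq α] (p : ℝ)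
    (F : Finset α) : ℝ := ∏ e, if e ∈ F then p else 1 - p

open Classical in
/-- The probability of the event `P` for a random subset of `α` of density `p`. -/
noncomputable def bernoulliProb {α : Type*} [Fintype α] (p : ℝ)
    (P : Finset α → Prop) : ℝ := ∑ F with P F, bernoulliWeight p F

section Bernoulli

variable {α : Type*} [Fintype α] [DecidableEq α]

theorem bernoulliWeight_nonneg {p : ℝ} (h0 : 0 ≤ p) (h1 : p ≤ 1) (F : Finset α) :
    0 ≤ bernoulliWeight p F :=
  prod_nonneg fun e _ => by split_ifs <;> linarith

theorem sum_bernoulliWeight_mul_prod (p : ℝ) (f g : α → ℝ) :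
    ∑ F : Finset α, bernoulliWeight p F * ∏ e, (if e ∈ F then f e else g e) =
      ∏ e, (p * f e + (1 - p) * g e) := by
  rw [prod_add]
  simp only [powerset_univ]
  refine sum_congr rfl fun F _ => ?_
  rw [bernoulliWeight, ← prod_mul_distrib, ← prod_sdiff (subset_univ F), mul_comm]
  congr 1
  · exact prod_congr rfl fun e he => by simp [he]
  · exact prod_congr rfl fun e he => by simp [(mem_sdiff.1 he).2]

theorem sum_bernoulliWeight (p : ℝ) : ∑ F : Finset α, bernoulliWeight p F = 1 := by
  simpa using sum_bernoulliWeight_mul_prod (α := α) p (fun _ => 1) (fun _ => 1)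

theorem bernoulliProb_eq_sum_ite (p : ℝ) (P : Finset α → Prop) [DecidablePred P] :
    bernoulliProb p P = ∑ F, if P F then bernoulliWeight p F else 0 := by
  rw [bernoulliProb, sum_filter]
  refine sum_congr rfl fun F _ => ?_
  congr!

theorem bernoulliProb_mono {p : ℝ} (h0 : 0 ≤ p) (h1 : p ≤ 1) {P Q : Finset α → Prop}
    (h : ∀ F, P F → Q F) : bernoulliProb p P ≤ bernoulliProb p Q := by
  classical
  rw [bernoulliProb_eq_sum_ite, bernoulliProb_eq_sum_ite]
  refine sum_le_sum fun F _ => ?_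
  have := bernoulliWeight_nonneg h0 h1 F
  by_cases hP : P F
  · simp [hP, h F hP]
  · simp only [hP, if_false]; split_ifs <;> simp [this]

theorem bernoulliProb_or_le {p : ℝ} (h0 : 0 ≤ p) (h1 : p ≤ 1) (P Q : Finset α → Prop) :
    bernoulliProb p (fun F => P F ∨ Q F) ≤ bernoulliProb p P + bernoulliProb p Q := by
  classical
  simp only [bernoulliProb_eq_sum_ite, ← sum_add_distrib]
  refine sum_le_sum fun F _ => ?_
  have := bernoulliWeight_nonneg h0 h1 F
  by_cases hP : P F <;> by_cases hQ : Q F <;> simp [hP, hQ, this]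

theorem bernoulliProb_exists_le {p : ℝ} (h0 : 0 ≤ p) (h1 : p ≤ 1) {ι : Type*} (s : Finset ι)
    (P : ι → Finset α → Prop) :
    bernoulliProb p (fun F => ∃ i ∈ s, P i F) ≤ ∑ i ∈ s, bernoulliProb p (P i) := by
  classical
  induction s using Finset.induction_on with
  | empty => simp [bernoulliProb]
  | insert a s ha ih =>
    rw [sum_insert ha]
    refine le_trans (bernoulliProb_mono h0 h1 (Q := fun F => P a F ∨ ∃ i ∈ s, P i F) ?_)
      ((bernoulliProb_or_le h0 h1 _ _).trans (by linarith))
    rintro F ⟨i, hi, hF⟩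
    rcases mem_insert.1 hi with rfl | hi
    · exact Or.inl hF
    · exact Or.inr ⟨i, hi, hF⟩

theorem exists_not_of_bernoulliProb_lt_one {p : ℝ} {P : Finset α → Prop}
    (h : bernoulliProb p P < 1) : ∃ F, ¬ P F := by
  classical
  by_contra! hP
  rw [bernoulliProb_eq_sum_ite] at h
  simp [hP, sum_bernoulliWeight] at h

/-- Markov's inequality for the exponential moment of a linear statistic. -/
theorem bernoulliProb_le_exp {p : ℝ} (h0 : 0 ≤ p) (h1 : p ≤ 1) (c : α → ℝ) (j : ℝ) :
    bernoulliProb p (fun F => j ≤ ∑ e ∈ F, c e) ≤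
      Real.exp (-j + p * ∑ e, (Real.exp (c e) - 1)) := by
  classical
  have key : ∏ e, (p * Real.exp (c e) + (1 - p) * 1) ≤
      Real.exp (p * ∑ e, (Real.exp (c e) - 1)) := by
    rw [mul_sum, Real.exp_sum]
    refine prod_le_prod (fun e _ => ?_) fun e _ => ?_
    · have := Real.exp_pos (c e); have := mul_nonneg h0 this.le; linarith
    · have := Real.add_one_le_exp (p * (Real.exp (c e) - 1)); linarith
  rw [← sum_bernoulliWeight_mul_prod] at key
  rw [Real.exp_add, bernoulliProb_eq_sum_ite]
  refine le_trans ?_ (mul_le_mul_of_nonneg_left key (Real.exp_pos _).le)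
  rw [mul_sum]
  refine sum_le_sum fun F _ => ?_
  have hw := bernoulliWeight_nonneg h0 h1 F
  have hprod : ∏ e, (if e ∈ F then Real.exp (c e) else 1) = Real.exp (∑ e ∈ F, c e) := by
    rw [Real.exp_sum, prod_ite_mem, univ_inter]
  rw [hprod, mul_left_comm, ← Real.exp_add]
  split_ifs with h
  · exact le_mul_of_one_le_right hw (Real.one_le_exp (by linarith))
  · positivity

theorem bernoulliProb_subset_disjoint (p : ℝ) {T S : Finset α} (h : Disjoint T S) :
    bernoulliProb p (fun F => T ⊆ F ∧ Disjoint S F) = p ^ #T * (1 - p) ^ #S := by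
  classical
  have h1 := sum_bernoulliWeight_mul_prod p (fun e => if e ∈ S then 0 else 1)
    (fun e => if e ∈ T then 0 else 1)
  have h2 : ∏ e, (p * (if e ∈ S then 0 else 1) + (1 - p) * (if e ∈ T then 0 else 1)) =
      p ^ #T * (1 - p) ^ #S := by
    have : ∀ e, (p * (if e ∈ S then 0 else 1) + (1 - p) * (if e ∈ T then 0 else 1)) =
        (if e ∈ T then p else 1) * (if e ∈ S then 1 - p else 1) := by
      intro e
      by_cases hT : e ∈ T
      · have : e ∉ S := disjoint_left.1 h hT
        simp [hT, this]
      · by_cases hS : e ∈ S <;> simp [hT, hS]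
    simp_rw [this]
    rw [prod_mul_distrib, prod_ite_mem, prod_ite_mem]
    simp
  rw [← h2, ← h1, bernoulliProb_eq_sum_ite]
  refine sum_congr rfl fun F _ => ?_
  split_ifs with hF
  · rw [prod_eq_one, mul_one]
    intro e _
    by_cases he : e ∈ F
    · have : e ∉ S := disjoint_right.1 hF.2 he
      simp [he, this]
    · have : e ∉ T := fun h => he (hF.1 h)
      simp [he, this]
  · symm
    rw [mul_eq_zero]; right
    rw [prod_eq_zero_iff]
    rw [not_and_or] at hF
    rcases hF with hF | hF
    · obtain ⟨e, heT, heF⟩ := not_subset.1 hF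
      exact ⟨e, mem_univ _, by simp [heT, heF]⟩
    · obtain ⟨e, heS, heF⟩ := not_disjoint_iff.1 hF
      exact ⟨e, mem_univ _, by simp [heS, heF]⟩

end Bernoulli

/-- Every finite family of finite sets contains a maximal pairwise disjoint subfamily. -/
theorem exists_maximal_pairwiseDisjoint {α : Type*} [DecidableEq α] (𝒯 : Finset (Finset α)) :
    ∃ 𝒰 ⊆ 𝒯, (𝒰 : Set (Finset α)).PairwiseDisjoint id ∧
      ∀ T ∈ 𝒯, (∀ U ∈ 𝒰, Disjoint T U) → T ∈ 𝒰 := by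
  classical
  obtain ⟨𝒰, h𝒰, hmax⟩ := (𝒯.powerset.filter
    fun 𝒰 : Finset (Finset α) => (𝒰 : Set (Finset α)).PairwiseDisjoint id).exists_max_image card
    ⟨∅, by simp⟩
  simp only [mem_filter, mem_powerset] at h𝒰 hmax
  refine ⟨𝒰, h𝒰.1, h𝒰.2, fun T hT hdisj => ?_⟩
  by_contra hTU
  have := hmax (insert T 𝒰) ⟨insert_subset hT h𝒰.1, by
    rw [coe_insert]
    exact h𝒰.2.insert fun U hU _ => hdisj U hU⟩
  rw [card_insert_of_notMem hTU] at this
  omega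

section Pruning

variable {α : Type*} [DecidableEq α]

/-- A maximal pairwise disjoint family of members of `𝒯` contained in `F`. -/
noncomputable def packing (𝒯 : Finset (Finset α)) (F : Finset α) : Finset (Finset α) :=
  (exists_maximal_pairwiseDisjoint (𝒯.filter (· ⊆ F))).choose

theorem packing_subset (𝒯 : Finset (Finset α)) (F : Finset α) :
    packing 𝒯 F ⊆ 𝒯.filter (· ⊆ F) :=
  (exists_maximal_pairwiseDisjoint (𝒯.filter (· ⊆ F))).choose_spec.1

theorem packing_pairwiseDisjoint (𝒯 : Finset (Finset α)) (F : Finset α) :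
    (packing 𝒯 F : Set (Finset α)).PairwiseDisjoint id :=
  (exists_maximal_pairwiseDisjoint (𝒯.filter (· ⊆ F))).choose_spec.2.1

theorem mem_packing_of_disjoint {𝒯 : Finset (Finset α)} {F T : Finset α}
    (hT : T ∈ 𝒯) (hTF : T ⊆ F) (h : ∀ U ∈ packing 𝒯 F, Disjoint T U) : T ∈ packing 𝒯 F :=
  (exists_maximal_pairwiseDisjoint (𝒯.filter (· ⊆ F))).choose_spec.2.2 T
    (mem_filter.2 ⟨hT, hTF⟩) h

/-- The set `F` with a maximal packing of members of `𝒯` deleted. -/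
noncomputable def prune (𝒯 : Finset (Finset α)) (F : Finset α) : Finset α :=
  F \ (packing 𝒯 F).biUnion id

theorem prune_subset (𝒯 : Finset (Finset α)) (F : Finset α) : prune 𝒯 F ⊆ F := sdiff_subset

theorem not_subset_prune {𝒯 : Finset (Finset α)} {F T : Finset α} (hT : T ∈ 𝒯)
    (hne : T.Nonempty) : ¬ T ⊆ prune 𝒯 F := by
  intro hsub
  have hdisj : ∀ U ∈ packing 𝒯 F, Disjoint T U := fun U hU =>
    disjoint_left.2 fun e heT heU =>
      (mem_sdiff.1 (hsub heT)).2 (mem_biUnion.2 ⟨U, hU, heU⟩)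
  have hmem := mem_packing_of_disjoint hT (hsub.trans (prune_subset _ _)) hdisj
  obtain ⟨e, he⟩ := hne
  exact disjoint_left.1 (hdisj T hmem) he he

/-- If `S` misses the pruned set, the removed members of `𝒯` meeting `S` cover `F ∩ S`. -/
theorem bernoulliProb_disjoint_prune_le [Fintype α] {p : ℝ} (h0 : 0 ≤ p) (h1 : p ≤ 1 / 2) {d : ℕ}
    (hd : d * p ^ 2 ≤ 1 / 16) {𝒯 : Finset (Finset α)} (hcard : ∀ T ∈ 𝒯, #T = 3)
    (hdeg : ∀ e, #(𝒯.filter (e ∈ ·)) ≤ d) (S : Finset α) :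
    bernoulliProb p (fun F => Disjoint S (prune 𝒯 F)) ≤ Real.exp (-(p * #S / 2)) := by
  classical
  set 𝒮 := 𝒯.filter (fun T => ¬ Disjoint T S) with h𝒮
  have h𝒮card : (#𝒮 : ℝ) ≤ d * #S := by
    have : 𝒮 ⊆ S.biUnion fun e => 𝒯.filter (e ∈ ·) := by
      intro T hT
      rw [h𝒮, mem_filter, not_disjoint_iff] at hT
      obtain ⟨hT, e, heT, heS⟩ := hT
      exact mem_biUnion.2 ⟨e, heS, mem_filter.2 ⟨hT, heT⟩⟩
    have h2 := (card_le_card this).trans (card_biUnion_le_card_mul S _ d fun e _ => hdeg e)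
    rw [mul_comm] at h2
    exact_mod_cast h2
  have hq : 1 / 2 ≤ 1 - p := by linarith
  have hq0 : 0 < 1 - p := by linarith
  have step : bernoulliProb p (fun F => Disjoint S (prune 𝒯 F)) ≤
      ∑ 𝒰 ∈ 𝒮.powerset, (1 - p) ^ #S * ((p / (1 - p)) ^ 3) ^ #𝒰 := by
    refine le_trans (bernoulliProb_mono h0 (by linarith)
      (Q := fun F => ∃ 𝒰 ∈ 𝒮.powerset.filter
        (fun 𝒰 : Finset (Finset α) => (𝒰 : Set (Finset α)).PairwiseDisjoint id),
        𝒰.biUnion id ⊆ F ∧ Disjoint (S \ 𝒰.biUnion id) F) ?_)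
      ((bernoulliProb_exists_le h0 (by linarith) _ _).trans ?_)
    · intro F hF
      refine ⟨(packing 𝒯 F).filter (fun T => ¬ Disjoint T S), ?_, ?_, ?_⟩
      · rw [mem_filter, mem_powerset]
        refine ⟨fun T hT => ?_, (packing_pairwiseDisjoint 𝒯 F).subset (by
          simp [Set.subset_def]; tauto)⟩
        rw [mem_filter] at hT
        exact mem_filter.2 ⟨(mem_filter.1 (packing_subset _ _ hT.1)).1, hT.2⟩
      · refine biUnion_subset.2 fun T hT => ?_
        exact (mem_filter.1 (packing_subset _ _ (mem_filter.1 hT).1)).2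
      · refine disjoint_left.2 fun e he heF => ?_
        rw [mem_sdiff] at he
        have hnp : e ∉ prune 𝒯 F := disjoint_left.1 hF he.1
        rw [prune, mem_sdiff, not_and_not_right] at hnp
        obtain ⟨T, hT, heT⟩ := mem_biUnion.1 (hnp heF)
        exact he.2 (mem_biUnion.2 ⟨T, mem_filter.2 ⟨hT, not_disjoint_iff.2 ⟨e, heT, he.1⟩⟩, heT⟩)
    · refine le_trans (sum_le_sum (g := fun 𝒰 => (1 - p) ^ #S * ((p / (1 - p)) ^ 3) ^ #𝒰) ?_)
        (sum_le_sum_of_subset_of_nonneg (filter_subset _ _) fun _ _ _ => by positivity)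
      intro 𝒰 h𝒰
      rw [mem_filter, mem_powerset] at h𝒰
      rw [bernoulliProb_subset_disjoint p disjoint_sdiff]
      have hU : #(𝒰.biUnion id) = 3 * #𝒰 := by
        rw [card_biUnion (fun x hx y hy hxy => h𝒰.2 hx hy hxy), mul_comm]
        exact sum_const_nat (m := 3) fun T hT => hcard T (mem_filter.1 (h𝒰.1 hT)).1
      have hS : #S ≤ #(S \ 𝒰.biUnion id) + 3 * #𝒰 := by
        have := le_card_sdiff (𝒰.biUnion id) S
        omega
      rw [hU, ← pow_mul, div_pow]
      have : (1 - p) ^ #(S \ 𝒰.biUnion id) * (1 - p) ^ (3 * #𝒰) ≤ (1 - p) ^ #S := by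
        rw [← pow_add]
        exact pow_le_pow_of_le_one hq0.le (by linarith) hS
      have h3 : (1 - p) ^ #(S \ 𝒰.biUnion id) ≤ (1 - p) ^ #S / (1 - p) ^ (3 * #𝒰) := by
        rwa [le_div_iff₀ (by positivity)]
      calc p ^ (3 * #𝒰) * (1 - p) ^ #(S \ 𝒰.biUnion id)
          ≤ p ^ (3 * #𝒰) * ((1 - p) ^ #S / (1 - p) ^ (3 * #𝒰)) := by gcongr
        _ = _ := by ring
  refine step.trans ?_
  rw [← mul_sum]
  have hsum : ∑ 𝒰 ∈ 𝒮.powerset, ((p / (1 - p)) ^ 3) ^ #𝒰 = ((p / (1 - p)) ^ 3 + 1) ^ #𝒮 := by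
    have := Finset.sum_pow_mul_eq_add_pow ((p / (1 - p)) ^ 3) 1 𝒮
    simpa using this
  rw [hsum]
  have hx : (p / (1 - p)) ^ 3 ≤ 8 * p ^ 3 := by
    have : p / (1 - p) ≤ 2 * p := by
      rw [div_le_iff₀ hq0]; nlinarith
    calc (p / (1 - p)) ^ 3 ≤ (2 * p) ^ 3 := by gcongr
      _ = _ := by ring
  have hA : (1 - p) ^ #S ≤ Real.exp (-(p * #S)) := by
    calc (1 - p) ^ #S ≤ (Real.exp (-p)) ^ #S := by
          gcongr; have := Real.add_one_le_exp (-p); linarith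
      _ = _ := by rw [← Real.exp_nat_mul]; ring_nf
  have hB : ((p / (1 - p)) ^ 3 + 1) ^ #𝒮 ≤ Real.exp (p * #S / 2) := by
    calc ((p / (1 - p)) ^ 3 + 1) ^ #𝒮 ≤ (Real.exp (8 * p ^ 3)) ^ #𝒮 := by
          gcongr; have := Real.add_one_le_exp (8 * p ^ 3); linarith
      _ = Real.exp (#𝒮 * (8 * p ^ 3)) := by rw [← Real.exp_nat_mul]
      _ ≤ _ := by
        apply Real.exp_le_exp.2
        calc (#𝒮 : ℝ) * (8 * p ^ 3) ≤ d * #S * (8 * p ^ 3) := by gcongr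
          _ = (d * p ^ 2) * (8 * (p * #S)) := by ring
          _ ≤ 1 / 16 * (8 * (p * #S)) := by gcongr
          _ = _ := by ring
  calc _ ≤ Real.exp (-(p * #S)) * Real.exp (p * #S / 2) := by gcongr
    _ = _ := by rw [← Real.exp_add]; ring_nf

end Pruning

section Triangles

variable {V : Type*} [Fintype V] [DecidableEq V]

/-- The edge sets of the triangles on the vertex set `V`. -/
def triangleEdgeSets (V : Type*) [Fintype V] [DecidableEq V] : Finset (Finset (Sym2 V)) :=
  (univ.filter fun t : V × V × V => t.1 ≠ t.2.1 ∧ t.1 ≠ t.2.2 ∧ t.2.1 ≠ t.2.2).image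
    fun t => {s(t.1, t.2.1), s(t.1, t.2.2), s(t.2.1, t.2.2)}

theorem mem_triangleEdgeSets {a b c : V} (hab : a ≠ b) (hac : a ≠ c) (hbc : b ≠ c) :
    ({s(a, b), s(a, c), s(b, c)} : Finset (Sym2 V)) ∈ triangleEdgeSets V :=
  mem_image.2 ⟨(a, b, c), by simp [hab, hac, hbc], rfl⟩

theorem card_of_mem_triangleEdgeSets {T : Finset (Sym2 V)} (hT : T ∈ triangleEdgeSets V) :
    #T = 3 := by
  obtain ⟨⟨a, b, c⟩, h, rfl⟩ := mem_image.1 hT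
  simp only [mem_filter, mem_univ, true_and] at h
  obtain ⟨hab, hac, hbc⟩ := h
  rw [card_eq_three]
  refine ⟨_, _, _, ?_, ?_, ?_, rfl⟩ <;> simp only [ne_eq, Sym2.eq_iff] <;> tauto

theorem card_filter_mem_triangleEdgeSets_le (e : Sym2 V) :
    #((triangleEdgeSets V).filter (e ∈ ·)) ≤ Fintype.card V := by
  induction e using Sym2.ind with
  | _ x y =>
    have : (triangleEdgeSets V).filter (s(x, y) ∈ ·) ⊆
        univ.image fun z : V => {s(x, y), s(x, z), s(y, z)} := by
      intro T hT
      rw [mem_filter] at hT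
      obtain ⟨hT, he⟩ := hT
      obtain ⟨⟨a, b, c⟩, h, rfl⟩ := mem_image.1 hT
      simp only [mem_insert, mem_singleton, Sym2.eq_iff] at he
      simp only [mem_image, mem_univ, true_and]
      rcases he with (⟨rfl, rfl⟩ | ⟨rfl, rfl⟩) | (⟨rfl, rfl⟩ | ⟨rfl, rfl⟩) |
        (⟨rfl, rfl⟩ | ⟨rfl, rfl⟩)
      · exact ⟨c, rfl⟩
      · exact ⟨c, by ext f; simp only [mem_insert, mem_singleton, Sym2.eq_swap (a := x)]; tauto⟩
      · exact ⟨b, by ext f; simp only [mem_insert, mem_singleton, Sym2.eq_swap (a := y)]; tauto⟩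
      · exact ⟨b, by
          ext f; simp only [mem_insert, mem_singleton, Sym2.eq_swap (a := x) (b := y),
            Sym2.eq_swap (a := x) (b := b)]; tauto⟩
      · exact ⟨a, by
          ext f; simp only [mem_insert, mem_singleton, Sym2.eq_swap (a := x) (b := a),
            Sym2.eq_swap (a := y) (b := a)]; tauto⟩
      · exact ⟨a, by
          ext f; simp only [mem_insert, mem_singleton, Sym2.eq_swap (a := y) (b := x),
            Sym2.eq_swap (a := x) (b := a), Sym2.eq_swap (a := y) (b := a)]; tauto⟩
    exact (card_le_card this).trans (card_image_le.trans (by simp))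

/-- The edges of `F` left after deleting a maximal edge-disjoint family of triangles. -/
noncomputable def trianglePrune (F : Finset (Sym2 V)) : Finset (Sym2 V) :=
  prune (triangleEdgeSets V) F

theorem trianglePrune_subset (F : Finset (Sym2 V)) : trianglePrune F ⊆ F := prune_subset _ _

theorem not_triangle_trianglePrune {F : Finset (Sym2 V)} {a b c : V} (hab : a ≠ b) (hac : a ≠ c)
    (hbc : b ≠ c) (h1 : s(a, b) ∈ trianglePrune F) (h2 : s(a, c) ∈ trianglePrune F)
    (h3 : s(b, c) ∈ trianglePrune F) : False := by
  refine not_subset_prune (mem_triangleEdgeSets hab hac hbc) (by simp) (?_ : _ ⊆ trianglePrune F)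
  simp [insert_subset_iff, h1, h2, h3]

theorem bernoulliProb_disjoint_trianglePrune_le {p : ℝ} (h0 : 0 ≤ p) (h1 : p ≤ 1 / 2)
    (hd : Fintype.card V * p ^ 2 ≤ 1 / 16) (S : Finset (Sym2 V)) :
    bernoulliProb p (fun F => Disjoint S (trianglePrune F)) ≤ Real.exp (-(p * #S / 2)) :=
  bernoulliProb_disjoint_prune_le h0 h1 hd (fun _ => card_of_mem_triangleEdgeSets)
    card_filter_mem_triangleEdgeSets_le S

end Triangles

section PseudoRandom

theorem sum_pow_card {V : Type*} [Fintype V] (r : ℝ) :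
    ∑ X : Finset V, r ^ #X = (r + 1) ^ Fintype.card V := by
  have := Finset.sum_pow_mul_eq_add_pow r 1 (univ : Finset V)
  simpa using this

variable {V : Type*} [DecidableEq V]

/-- The number of neighbours of `w` in `X`, in the graph with edge set `F`. -/
def nbrCount (F : Finset (Sym2 V)) (X : Finset V) (w : V) : ℕ := #{a ∈ X | a ≠ w ∧ s(a, w) ∈ F}

/-- The number of ways to write `e` as a pair in `X × W`. -/
def pairCount (X W : Finset V) (e : Sym2 V) : ℕ :=
  #{x ∈ X ×ˢ W | x.1 ≠ x.2 ∧ s(x.1, x.2) = e}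

/-- The vertices `a` and `b` have a common neighbour. -/
def HasCommonNbr (F : Finset (Sym2 V)) (a b : V) : Prop :=
  ∃ w, a ≠ w ∧ b ≠ w ∧ s(a, w) ∈ F ∧ s(b, w) ∈ F

/-- Vertices with at least `D` neighbours in a set `X` of size at most `x₀` send at most
`L * #X` edges to `X`. -/
def LocallySparse (F : Finset (Sym2 V)) (x₀ : ℝ) (D L : ℕ) : Prop :=
  ∀ X W : Finset V, (#X : ℝ) ≤ x₀ → (∀ w ∈ W, D ≤ nbrCount F X w) →
    ∑ w ∈ W, nbrCount F X w ≤ L * #X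

/-- All degrees of the graph with edge set `F` are at most `Δ`. -/
def DegreesLE [Fintype V] (F : Finset (Sym2 V)) (Δ : ℝ) : Prop := ∀ w, (nbrCount F univ w : ℝ) ≤ Δ

theorem sum_nbrCount_eq (F : Finset (Sym2 V)) (X W : Finset V) :
    ∑ w ∈ W, nbrCount F X w = ∑ e ∈ F, pairCount X W e := by
  have h1 : ∑ e ∈ F, pairCount X W e = #{x ∈ X ×ˢ W | x.1 ≠ x.2 ∧ s(x.1, x.2) ∈ F} := by
    rw [card_eq_sum_card_fiberwise (f := fun x => s(x.1, x.2)) (t := F)]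
    · refine sum_congr rfl fun e he => ?_
      rw [pairCount, filter_filter]
      congr 1
      refine filter_congr fun x _ => ?_
      constructor
      · rintro ⟨h, rfl⟩; exact ⟨⟨h, he⟩, rfl⟩
      · rintro ⟨⟨h, _⟩, h2⟩; exact ⟨h, h2⟩
    · intro x hx
      simp only [coe_filter, Set.mem_ofPred_eq] at hx
      exact hx.2.2
  rw [h1, card_filter, sum_product_right]
  refine sum_congr rfl fun w _ => ?_
  rw [nbrCount, card_filter]

theorem pairCount_le_two (X W : Finset V) (e : Sym2 V) : pairCount X W e ≤ 2 := by
  induction e using Sym2.ind with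
  | _ a b =>
    refine (card_le_card (t := {(a, b), (b, a)}) ?_).trans card_le_two
    rintro ⟨x, y⟩ hx
    simp only [mem_filter, Sym2.eq_iff] at hx
    simp only [mem_insert, mem_singleton, Prod.mk.injEq]
    exact hx.2.2

variable [Fintype V]

theorem sum_pairCount_le (X W : Finset V) : ∑ e, pairCount X W e ≤ #X * #W := by
  rw [← sum_nbrCount_eq, mul_comm]
  refine (sum_le_card_nsmul W _ #X fun w _ => card_le_card (filter_subset _ _)).trans (by simp)

theorem bernoulliProb_le_nbrCount_le {p : ℝ} (h0 : 0 ≤ p) (h1 : p ≤ 1) {θ : ℝ} (hθ : 0 ≤ θ)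
    (X W : Finset V) (j : ℝ) :
    bernoulliProb p (fun F => j ≤ θ * ((∑ w ∈ W, nbrCount F X w : ℕ) : ℝ)) ≤
      Real.exp (-j + p * Real.exp (2 * θ) * #X * #W) := by
  have h := bernoulliProb_le_exp h0 h1 (fun e => θ * (pairCount X W e : ℝ)) j
  simp only [sum_nbrCount_eq, Nat.cast_sum, mul_sum]
  refine h.trans (Real.exp_le_exp.2 ?_)
  have hb : ∑ e, (Real.exp (θ * (pairCount X W e : ℝ)) - 1) ≤
      ∑ e, Real.exp (2 * θ) * (pairCount X W e : ℝ) := by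
    refine sum_le_sum fun e _ => ?_
    have h2 := pairCount_le_two X W e
    have he1 : Real.exp θ ≤ Real.exp (2 * θ) := Real.exp_le_exp.2 (by linarith)
    have he2 := Real.exp_pos (2 * θ)
    interval_cases pairCount X W e
    · simp
    · simp only [Nat.cast_one, mul_one]; linarith
    · simp only [Nat.cast_ofNat, mul_comm θ 2]; linarith
  have hc : ∑ e, Real.exp (2 * θ) * (pairCount X W e : ℝ) ≤ Real.exp (2 * θ) * (#X * #W) := by
    rw [← mul_sum]
    gcongr
    exact_mod_cast sum_pairCount_le X W
  have := mul_le_mul_of_nonneg_left (hb.trans hc) h0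
  linarith

theorem bernoulliProb_not_locallySparse_le {p : ℝ} (h0 : 0 ≤ p) (h1 : p ≤ 1) {θ x₀ : ℝ}
    (hθ : 0 ≤ θ) {D L : ℕ} (hD : p * Real.exp (2 * θ) * x₀ ≤ θ * D / 4)
    (hL : Fintype.card V * Real.exp (-(θ * L / 2)) ≤ 1 / 32)
    (hD' : Fintype.card V * Real.exp (-(θ * D / 4)) ≤ 1 / 2) :
    bernoulliProb p (fun F : Finset (Sym2 V) => ¬ LocallySparse F x₀ D L) ≤ 1 / 8 := by
  classical
  set r := Real.exp (-(θ * L / 2)) with hr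
  set s := Real.exp (-(θ * D / 4)) with hs
  have hr0 : 0 < r := Real.exp_pos _
  have hs0 : 0 < s := Real.exp_pos _
  have hbound : ∀ y : ℝ, 0 ≤ y → Fintype.card V * y ≤ 1 →
      (y + 1) ^ Fintype.card V ≤ 1 + 2 * (Fintype.card V * y) := by
    intro y hy hy1
    have h3 : (y + 1) ^ Fintype.card V ≤ Real.exp (Fintype.card V * y) := by
      rw [Real.exp_nat_mul]
      gcongr
      exact Real.add_one_le_exp y
    have h4 := Real.abs_exp_sub_one_le (x := Fintype.card V * y)
      (by rwa [abs_of_nonneg (by positivity)])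
    have h5 := le_abs_self (Real.exp (Fintype.card V * y) - 1)
    rw [abs_of_nonneg (a := Fintype.card V * y) (by positivity)] at h4
    linarith
  refine le_trans (bernoulliProb_mono h0 h1 (Q := fun F => ∃ XW ∈
      ((univ.erase ∅ : Finset (Finset V)).filter fun X => (#X : ℝ) ≤ x₀) ×ˢ
        (univ : Finset (Finset V)),
      θ * (D * #XW.2 + L * #XW.1) / 2 ≤ θ * ((∑ w ∈ XW.2, nbrCount F XW.1 w : ℕ) : ℝ)) ?_)
    ((bernoulliProb_exists_le h0 h1 _ _).trans ?_)
  · intro F hF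
    simp only [LocallySparse, not_forall, not_le] at hF
    obtain ⟨X, W, hX, hW, hlt⟩ := hF
    refine ⟨(X, W), ?_, ?_⟩
    · simp only [mem_product, mem_filter, mem_erase, mem_univ, and_true, hX]
      rintro rfl
      simp [nbrCount] at hlt
    · have h2 : D * #W ≤ ∑ w ∈ W, nbrCount F X w := by
        have := card_nsmul_le_sum W _ D hW
        simpa [mul_comm] using this
      have h2' : (D * #W : ℝ) ≤ ((∑ w ∈ W, nbrCount F X w : ℕ) : ℝ) := by exact_mod_cast h2
      have h3' : (L * #X : ℝ) ≤ ((∑ w ∈ W, nbrCount F X w : ℕ) : ℝ) := by exact_mod_cast hlt.le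
      have := mul_le_mul_of_nonneg_left (add_le_add h2' h3') hθ
      dsimp only
      linarith
  · calc _ ≤ ∑ XW ∈ ((univ.erase ∅ : Finset (Finset V)).filter fun X => (#X : ℝ) ≤ x₀) ×ˢ
          (univ : Finset (Finset V)), r ^ #XW.1 * s ^ #XW.2 := by
          refine sum_le_sum fun XW hXW => ?_
          simp only [mem_product, mem_filter, mem_univ, and_true] at hXW
          refine (bernoulliProb_le_nbrCount_le h0 h1 hθ _ _ _).trans ?_
          rw [hr, hs, ← Real.exp_nat_mul, ← Real.exp_nat_mul, ← Real.exp_add]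
          apply Real.exp_le_exp.2
          have h5 : p * Real.exp (2 * θ) * #XW.1 ≤ θ * D / 4 :=
            le_trans (mul_le_mul_of_nonneg_left hXW.2 (by positivity)) hD
          have := mul_le_mul_of_nonneg_right h5 (Nat.cast_nonneg (α := ℝ) #XW.2)
          linarith
      _ ≤ ∑ XW ∈ (univ.erase ∅ : Finset (Finset V)) ×ˢ (univ : Finset (Finset V)),
          r ^ #XW.1 * s ^ #XW.2 :=
          sum_le_sum_of_subset_of_nonneg (product_subset_product_left (filter_subset _ _))
            fun _ _ _ => by positivity
      _ = (∑ X ∈ (univ.erase ∅ : Finset (Finset V)), r ^ #X) * ∑ W : Finset V, s ^ #W := by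
          rw [sum_mul_sum, sum_product]
      _ = ((r + 1) ^ Fintype.card V - 1) * (s + 1) ^ Fintype.card V := by
          rw [← sum_pow_card, ← sum_pow_card,
            ← add_sum_erase (univ : Finset (Finset V)) (fun X => r ^ #X) (mem_univ ∅)]
          simp
      _ ≤ (2 * (1 / 32)) * (1 + 2 * (1 / 2)) := by
          have := hbound r hr0.le (by linarith)
          have := hbound s hs0.le (by linarith)
          gcongr <;> linarith
      _ = 1 / 8 := by norm_num

theorem bernoulliProb_not_degreesLE_le {p : ℝ} (h0 : 0 ≤ p) (h1 : p ≤ 1) (Δ : ℝ) :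
    bernoulliProb p (fun F : Finset (Sym2 V) => ¬ DegreesLE F Δ) ≤
      Fintype.card V * Real.exp (-Δ + p * Real.exp 2 * Fintype.card V) := by
  refine le_trans (bernoulliProb_mono h0 h1 (Q := fun F => ∃ w ∈ (univ : Finset V),
      Δ ≤ 1 * ((∑ w ∈ {w}, nbrCount F univ w : ℕ) : ℝ)) ?_)
    ((bernoulliProb_exists_le h0 h1 _ _).trans ?_)
  · intro F hF
    simp only [DegreesLE, not_forall, not_le] at hF
    obtain ⟨w, hw⟩ := hF
    exact ⟨w, mem_univ _, by simpa using hw.le⟩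
  · calc _ ≤ ∑ w : V, Real.exp (-Δ + p * Real.exp 2 * Fintype.card V) := by
          refine sum_le_sum fun w _ => ?_
          have := bernoulliProb_le_nbrCount_le h0 h1 zero_le_one univ {w} Δ
          rw [mul_one, card_singleton, Nat.cast_one, mul_one, card_univ] at this
          exact this
      _ = _ := by simp

open Classical in
theorem card_hasCommonNbr_le {F : Finset (Sym2 V)} {x₀ Δ : ℝ} {D L : ℕ}
    (hF : LocallySparse F x₀ D L) (hΔ : DegreesLE F Δ) {X : Finset V} (hX : (#X : ℝ) ≤ x₀) :
    (#{x ∈ X ×ˢ X | HasCommonNbr F x.1 x.2} : ℝ) ≤ Δ * (D + L) * #X := by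
  have hle : ∀ w, (nbrCount F X w : ℝ) ≤ Δ := fun w =>
    le_trans (by exact_mod_cast card_le_card (filter_subset_filter _ (subset_univ X))) (hΔ w)
  have hsum : (∑ w, nbrCount F X w : ℝ) ≤ Δ * #X := by
    have h1 : ∑ w, nbrCount F X w = ∑ w ∈ X, nbrCount F univ w := by
      simp only [nbrCount, card_filter]
      rw [sum_comm]
      refine sum_congr rfl fun a _ => sum_congr rfl fun b _ => ?_
      simp only [ne_comm (a := a), Sym2.eq_swap (a := a)]
    have h2 : (∑ w ∈ X, nbrCount F univ w : ℝ) ≤ #X • Δ := sum_le_card_nsmul _ _ _ fun w _ => hΔ w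
    rw [nsmul_eq_mul, mul_comm] at h2
    calc _ = ((∑ w, nbrCount F X w : ℕ) : ℝ) := by push_cast; rfl
      _ = _ := by rw [h1]; push_cast; rfl
      _ ≤ _ := h2
  have hcard : #{x ∈ X ×ˢ X | HasCommonNbr F x.1 x.2} ≤ ∑ w, nbrCount F X w * nbrCount F X w := by
    have : {x ∈ X ×ˢ X | HasCommonNbr F x.1 x.2} ⊆ univ.biUnion fun w =>
        {a ∈ X | a ≠ w ∧ s(a, w) ∈ F} ×ˢ {a ∈ X | a ≠ w ∧ s(a, w) ∈ F} := by
      rintro ⟨a, b⟩ hab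
      simp only [mem_filter, mem_product] at hab
      obtain ⟨⟨ha, hb⟩, w, h1, h2, h3, h4⟩ := hab
      simp only [mem_biUnion, mem_univ, true_and, mem_product, mem_filter]
      exact ⟨w, ⟨ha, h1, h3⟩, hb, h2, h4⟩
    refine (card_le_card this).trans (card_biUnion_le.trans ?_)
    simp [card_product, nbrCount]
  have hdense := hF X {w | D ≤ nbrCount F X w} hX (by simp)
  calc (#{x ∈ X ×ˢ X | HasCommonNbr F x.1 x.2} : ℝ)
      ≤ ∑ w, (nbrCount F X w : ℝ) * nbrCount F X w := by exact_mod_cast hcard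
    _ ≤ ∑ w, (D * (nbrCount F X w : ℝ) +
          Δ * if D ≤ nbrCount F X w then (nbrCount F X w : ℝ) else 0) := by
        refine sum_le_sum fun w _ => ?_
        have h0 : (0 : ℝ) ≤ nbrCount F X w := Nat.cast_nonneg _
        split_ifs with h
        · have := mul_le_mul_of_nonneg_right (hle w) h0
          have : (0 : ℝ) ≤ D * (nbrCount F X w : ℝ) := by positivity
          linarith
        · have : (nbrCount F X w : ℝ) ≤ D := by exact_mod_cast (not_le.1 h).le
          nlinarith
    _ = D * ∑ w, (nbrCount F X w : ℝ) +
          Δ * ∑ w with D ≤ nbrCount F X w, (nbrCount F X w : ℝ) := by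
        rw [sum_add_distrib, ← mul_sum, ← mul_sum, sum_filter]
    _ ≤ D * (Δ * #X) + Δ * (L * #X) := by
        have hd' : (∑ w with D ≤ nbrCount F X w, (nbrCount F X w : ℝ)) ≤ L * #X := by
          exact_mod_cast hdense
        rcases isEmpty_or_nonempty V with hV | ⟨⟨v⟩⟩
        · simp [Finset.eq_empty_of_isEmpty X]
        · have hΔ0 : 0 ≤ Δ := le_trans (Nat.cast_nonneg _) (hΔ v)
          gcongr
    _ = _ := by ring

end PseudoRandom

section Weighted

variable {V M : Type*} [DecidableEq M]

open Classical in
/-- Pulling back a sparse relation along a map with small fibres. -/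
theorem card_pullback_le [Fintype M] {C : M → M → Prop} {x₀ K : ℝ} {t : ℕ} (φ : V → M) (I : Finset V)
    (hfib : ∀ a, #{v ∈ I | φ v = a} ≤ t) (himg : (#(I.image φ) : ℝ) ≤ x₀)
    (hC : ∀ X : Finset M, (#X : ℝ) ≤ x₀ → (#{x ∈ X ×ˢ X | C x.1 x.2} : ℝ) ≤ K * #X) :
    (#{v ∈ I ×ˢ I | C (φ v.1) (φ v.2)} : ℝ) ≤ t * (K * #I) := by
  set μ : M → ℕ := fun a => #{v ∈ I | φ v = a} with hμ
  have h1 : #{v ∈ I ×ˢ I | C (φ v.1) (φ v.2)} =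
      ∑ x : M × M with C x.1 x.2, μ x.1 * μ x.2 := by
    rw [card_eq_sum_card_fiberwise (f := fun v => (φ v.1, φ v.2))
      (t := univ.filter fun x : M × M => C x.1 x.2) (by intro v hv; simp at hv; simp [hv])]
    refine sum_congr rfl fun x hx => ?_
    rw [hμ, ← card_product]
    congr 1
    ext v
    simp only [mem_filter, mem_univ, true_and] at hx
    simp only [mem_filter, mem_product, Prod.ext_iff]
    constructor
    · rintro ⟨⟨⟨h1, h2⟩, _⟩, h3, h4⟩; exact ⟨⟨h1, h3⟩, h2, h4⟩
    · rintro ⟨⟨h1, h3⟩, h2, h4⟩; exact ⟨⟨⟨h1, h2⟩, by rw [h3, h4]; exact hx⟩, h3, h4⟩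
  have hmin : ∀ a b, a ≤ t → b ≤ t → a * b ≤ t * #{i ∈ range t | i < a ∧ i < b} := by
    intro a b ha hb
    have : {i ∈ range t | i < a ∧ i < b} = range (min a b) := by
      ext i; simp; omega
    rw [this, card_range]
    rcases le_total a b with h | h
    · rw [min_eq_left h, mul_comm]; gcongr
    · rw [min_eq_right h]; gcongr
  have h2 : ∑ x : M × M with C x.1 x.2, μ x.1 * μ x.2 ≤
      t * ∑ i ∈ range t, #{x ∈ ({a | i < μ a} : Finset M) ×ˢ ({a | i < μ a} : Finset M) |
        C x.1 x.2} := by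
    refine (sum_le_sum fun x _ => hmin _ _ (hfib _) (hfib _)).trans ?_
    rw [← mul_sum]
    gcongr
    have : ∀ i, {x ∈ ({a | i < μ a} : Finset M) ×ˢ ({a | i < μ a} : Finset M) | C x.1 x.2} =
        {x ∈ (univ.filter fun x : M × M => C x.1 x.2) | i < μ x.1 ∧ i < μ x.2} := by
      intro i; ext x; simp; tauto
    simp only [this]
    simp only [card_filter (fun x : M × M => _ < μ x.1 ∧ _ < μ x.2)]
    rw [sum_comm]
    refine sum_le_sum fun x _ => ?_
    rw [card_filter]
  have h3 : ∑ i ∈ range t, #({a | i < μ a} : Finset M) = #I := by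
    rw [card_eq_sum_card_fiberwise (f := φ) (t := univ) (by simp)]
    simp only [card_filter (fun a => _ < μ a)]
    rw [sum_comm]
    refine sum_congr rfl fun a _ => ?_
    rw [← card_filter]
    have : {i ∈ range t | i < μ a} = range (μ a) := by
      ext i; have := hfib a; simp; grind
    rw [this, card_range]
  have h4 : ∀ i, (#{x ∈ ({a | i < μ a} : Finset M) ×ˢ ({a | i < μ a} : Finset M) |
      C x.1 x.2} : ℝ) ≤ K * #({a | i < μ a} : Finset M) := by
    intro i
    apply hC
    refine le_trans ?_ himg
    norm_cast
    refine card_le_card fun a ha => ?_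
    simp only [mem_filter, mem_univ, true_and] at ha
    obtain ⟨v, hv⟩ := card_pos.1 (Nat.zero_lt_of_lt ha)
    rw [mem_filter] at hv
    exact mem_image.2 ⟨v, hv⟩
  rw [h1]
  calc ((∑ x : M × M with C x.1 x.2, μ x.1 * μ x.2 : ℕ) : ℝ)
      ≤ t * ∑ i ∈ range t, (#{x ∈ ({a | i < μ a} : Finset M) ×ˢ ({a | i < μ a} : Finset M) |
        C x.1 x.2} : ℝ) := by exact_mod_cast h2
    _ ≤ t * ∑ i ∈ range t, K * (#({a | i < μ a} : Finset M) : ℝ) := by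
        gcongr with i hi
        exact h4 i
    _ = t * (K * #I) := by
        rw [← mul_sum, ← h3]; push_cast; rfl

end Weighted

open Classical in
/-- Two independent random sets can be chosen to satisfy a common property `Good` together with
two properties each of which is likely for one set once the other is `Good`. -/
theorem exists_good_pair {α : Type*} [Fintype α] [DecidableEq α] {p : ℝ} (h0 : 0 ≤ p) (h1 : p ≤ 1)
    {Good : Finset α → Prop} {P Q : Finset α → Finset α → Prop}
    (hGood : bernoulliProb p (fun F => ¬ Good F) ≤ 3 / 8)
    (hP : ∀ F₂, Good F₂ → bernoulliProb p (fun F₁ => P F₁ F₂) ≤ 1 / 16)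
    (hQ : ∀ F₁, Good F₁ → bernoulliProb p (fun F₂ => Q F₁ F₂) ≤ 1 / 16) :
    ∃ F₁ F₂, Good F₁ ∧ Good F₂ ∧ ¬ P F₁ F₂ ∧ ¬ Q F₁ F₂ := by
  by_contra! hcon
  set w : Finset α → ℝ := bernoulliWeight p with hw
  have hw0 : ∀ F, 0 ≤ w F := bernoulliWeight_nonneg h0 h1
  have hw1 : ∑ F, w F = 1 := sum_bernoulliWeight p
  set a : ℝ := bernoulliProb p (fun F => ¬ Good F) with ha
  have hrow : ∀ F₂, ∑ F₁, w F₁ * (if Good F₂ ∧ P F₁ F₂ then 1 else 0) ≤ 1 / 16 := by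
    intro F₂
    by_cases hF : Good F₂
    · refine le_trans (le_of_eq ?_) (hP F₂ hF)
      rw [bernoulliProb_eq_sum_ite]
      simp [hF, hw]
    · simp [hF]
  have hcol : ∀ F₁, ∑ F₂, w F₂ * (if Good F₁ ∧ Q F₁ F₂ then 1 else 0) ≤ 1 / 16 := by
    intro F₁
    by_cases hF : Good F₁
    · refine le_trans (le_of_eq ?_) (hQ F₁ hF)
      rw [bernoulliProb_eq_sum_ite]
      simp [hF, hw]
    · simp [hF]
  have hbad : ∑ F, w F * (if Good F then 0 else 1) = a := by
    rw [ha, bernoulliProb_eq_sum_ite]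
    simp [hw]
  have htotal : ∑ F₁, ∑ F₂, w F₁ * w F₂ = 1 := by rw [← sum_mul_sum, hw1, one_mul]
  have hle : ∑ F₁, ∑ F₂, w F₁ * w F₂ ≤
      ∑ F₁, ∑ F₂, ((w F₁ * (if Good F₁ then 0 else 1)) * w F₂ +
        w F₁ * (w F₂ * (if Good F₂ then 0 else 1)) +
        w F₂ * (w F₁ * (if Good F₂ ∧ P F₁ F₂ then 1 else 0)) +
        w F₁ * (w F₂ * (if Good F₁ ∧ Q F₁ F₂ then 1 else 0))) := by
    refine sum_le_sum fun F₁ _ => sum_le_sum fun F₂ _ => ?_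
    have hpos : 0 ≤ w F₁ * w F₂ := mul_nonneg (hw0 _) (hw0 _)
    have := hcon F₁ F₂
    by_cases hG1 : Good F₁ <;> by_cases hG2 : Good F₂ <;> by_cases hP1 : P F₁ F₂ <;>
      by_cases hQ1 : Q F₁ F₂ <;> simp only [hG1, hG2, hP1, hQ1] <;> simp <;> try nlinarith
    exact absurd (this hG1 hG2 hP1) hQ1
  have e1 : ∑ F₁, ∑ F₂, (w F₁ * (if Good F₁ then 0 else 1)) * w F₂ = a := by
    rw [← sum_mul_sum, hw1, hbad, mul_one]
  have e2 : ∑ F₁, ∑ F₂, w F₁ * (w F₂ * (if Good F₂ then 0 else 1)) = a := by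
    rw [← sum_mul_sum, hw1, hbad, one_mul]
  have e3 : ∑ F₁, ∑ F₂, w F₂ * (w F₁ * (if Good F₂ ∧ P F₁ F₂ then 1 else 0)) ≤ 1 / 16 := by
    rw [sum_comm]
    calc _ = ∑ F₂, w F₂ * ∑ F₁, (w F₁ * (if Good F₂ ∧ P F₁ F₂ then 1 else 0)) := by
          simp only [mul_sum]
      _ ≤ ∑ F₂, w F₂ * (1 / 16) := sum_le_sum fun F₂ _ => mul_le_mul_of_nonneg_left (hrow F₂) (hw0 _)
      _ = 1 / 16 := by rw [← sum_mul, hw1, one_mul]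
  have e4 : ∑ F₁, ∑ F₂, w F₁ * (w F₂ * (if Good F₁ ∧ Q F₁ F₂ then 1 else 0)) ≤ 1 / 16 := by
    calc _ = ∑ F₁, w F₁ * ∑ F₂, (w F₂ * (if Good F₁ ∧ Q F₁ F₂ then 1 else 0)) := by
          simp only [mul_sum]
      _ ≤ ∑ F₁, w F₁ * (1 / 16) := sum_le_sum fun F₁ _ => mul_le_mul_of_nonneg_left (hcol F₁) (hw0 _)
      _ = 1 / 16 := by rw [← sum_mul, hw1, one_mul]
  simp only [sum_add_distrib] at hle
  linarith

theorem HasCommonNbr.symm {M : Type*} {F : Finset (Sym2 M)} {a b : M} (h : HasCommonNbr F a b) :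
    HasCommonNbr F b a := by
  obtain ⟨w, h1, h2, h3, h4⟩ := h
  exact ⟨w, h2, h1, h4, h3⟩

section Overlay

variable {V M : Type*} [Fintype M] [DecidableEq M]

open Classical in
/-- A positive proportion of the pairs of a set are unrelated, if the relation `R` is sparse and
sparser still on small sets. -/
theorem card_unrelated_ge {R : M → M → Prop} {x₀ K K' : ℝ} {q t τ : ℕ} (ht : 0 < t)
    (hx₀ : (q : ℝ) / t ≤ x₀) (hK : τ * K ≤ q / 4) (hK' : t * K' ≤ q / 4)
    (hR : ∀ X : Finset M, (#X : ℝ) ≤ x₀ → (#{x ∈ X ×ˢ X | R x.1 x.2} : ℝ) ≤ K * #X)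
    (hR' : ∀ X : Finset M, (#X : ℝ) ≤ q → (#{x ∈ X ×ˢ X | R x.1 x.2} : ℝ) ≤ K' * #X)
    (φ : V → M) {J : Finset V} (hJ : #J = q) (hfib : ∀ a, #{v ∈ J | φ v = a} ≤ τ) :
    (q : ℝ) ^ 2 / 8 ≤ #{v ∈ J ×ˢ J | ¬ R (φ v.1) (φ v.2)} := by
  have main : ∀ J' ⊆ J, (q : ℝ) / 2 ≤ #J' →
      (#{v ∈ J' ×ˢ J' | R (φ v.1) (φ v.2)} : ℝ) ≤ q / 4 * #J' →
      (q : ℝ) ^ 2 / 8 ≤ #{v ∈ J ×ˢ J | ¬ R (φ v.1) (φ v.2)} := by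
    intro J' hsub hhalf hrel
    have h1 : (#{v ∈ J' ×ˢ J' | R (φ v.1) (φ v.2)} : ℝ) +
        #{v ∈ J' ×ˢ J' | ¬ R (φ v.1) (φ v.2)} = #J' * #J' := by
      have := card_filter_add_card_filter_not (s := J' ×ˢ J') (fun v => R (φ v.1) (φ v.2))
      rw [card_product] at this
      exact_mod_cast this
    have h2 : (#{v ∈ J' ×ˢ J' | ¬ R (φ v.1) (φ v.2)} : ℝ) ≤
        #{v ∈ J ×ˢ J | ¬ R (φ v.1) (φ v.2)} := by
      exact_mod_cast card_le_card (filter_subset_filter _ (product_subset_product hsub hsub))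
    have hq : (0 : ℝ) ≤ q := Nat.cast_nonneg q
    nlinarith
  set Jh := {v ∈ J | t < #{u ∈ J | φ u = φ v}} with hJh
  set Jl := {v ∈ J | ¬ t < #{u ∈ J | φ u = φ v}} with hJl
  have hsum : (#Jh : ℝ) + #Jl = q := by
    have := card_filter_add_card_filter_not (s := J) (fun v => t < #{u ∈ J | φ u = φ v})
    rw [hJ] at this
    exact_mod_cast this
  rcases le_total (q / 2 : ℝ) #Jh with hh | hh
  · refine main Jh (filter_subset _ _) hh ?_
    have himg : (#(Jh.image φ) : ℝ) ≤ x₀ := by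
      refine le_trans ?_ hx₀
      rw [le_div_iff₀ (by exact_mod_cast ht)]
      have : t * #(Jh.image φ) ≤ #Jh := by
        refine mul_card_image_le_card_of_maps_to (fun v hv => mem_image_of_mem φ hv) t ?_
        intro a ha
        obtain ⟨v, hv, rfl⟩ := mem_image.1 ha
        have hv' := (mem_filter.1 hv).2
        refine hv'.le.trans (card_le_card fun u hu => ?_)
        simp only [hJh, mem_filter] at hu hv ⊢
        exact ⟨⟨hu.1, by rw [hu.2]; exact hv.2⟩, hu.2⟩
      have h2 : #Jh ≤ q := hJ ▸ card_le_card (filter_subset _ _)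
      rw [mul_comm]
      exact_mod_cast this.trans h2
    have := card_pullback_le φ Jh (t := τ)
      (fun a => (card_le_card (filter_subset_filter _ (filter_subset _ _))).trans (hfib a)) himg hR
    refine this.trans ?_
    rw [← mul_assoc]
    gcongr
  · refine main Jl (filter_subset _ _) (by linarith) ?_
    have himg : (#(Jl.image φ) : ℝ) ≤ q := by
      exact_mod_cast card_image_le.trans (hJ ▸ card_le_card (filter_subset _ _))
    have := card_pullback_le φ Jl (t := t) (fun a => ?_) himg hR'
    · refine this.trans ?_
      rw [← mul_assoc]
      gcongr
    · rcases ({v ∈ Jl | φ v = a} : Finset V).eq_empty_or_nonempty with he | ⟨v, hv⟩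
      · simp [he]
      · simp only [hJl, mem_filter, not_lt] at hv
        obtain ⟨⟨hvJ, hvt⟩, rfl⟩ := hv
        exact (card_le_card (filter_subset_filter _ (filter_subset _ _))).trans hvt

/-- The pair `u, v` is an edge of the first pruned graph, and joining it creates no triangle
with two edges of the second graph. -/
def OverlayAdj (F₁ F₂ : Finset (Sym2 M)) (φ₁ φ₂ : V → M) (u v : V) : Prop :=
  φ₁ u ≠ φ₁ v ∧ s(φ₁ u, φ₁ v) ∈ trianglePrune F₁ ∧ φ₂ u ≠ φ₂ v ∧
    ¬ HasCommonNbr F₂ (φ₂ u) (φ₂ v)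

theorem OverlayAdj.symm {F₁ F₂ : Finset (Sym2 M)} {φ₁ φ₂ : V → M} {u v : V}
    (h : OverlayAdj F₁ F₂ φ₁ φ₂ u v) : OverlayAdj F₁ F₂ φ₁ φ₂ v u :=
  ⟨h.1.symm, Sym2.eq_swap ▸ h.2.1, h.2.2.1.symm, fun hc => h.2.2.2 hc.symm⟩

theorem OverlayAdj.not_path {F₁ F₂ : Finset (Sym2 M)} {φ₁ φ₂ : V → M} {u v w : V}
    (h : OverlayAdj F₁ F₂ φ₁ φ₂ u v) (h1 : OverlayAdj F₂ F₁ φ₂ φ₁ u w)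
    (h2 : OverlayAdj F₂ F₁ φ₂ φ₁ v w) : False :=
  h.2.2.2 ⟨φ₂ w, h1.1, h2.1, trianglePrune_subset _ h1.2.1, trianglePrune_subset _ h2.2.1⟩

theorem OverlayAdj.not_triangle {F₁ F₂ : Finset (Sym2 M)} {φ₁ φ₂ : V → M} {u v w : V}
    (h : OverlayAdj F₁ F₂ φ₁ φ₂ u v) (h1 : OverlayAdj F₁ F₂ φ₁ φ₂ u w)
    (h2 : OverlayAdj F₁ F₂ φ₁ φ₂ v w) : False :=
  not_triangle_trianglePrune h.1 h1.1 h2.1 h.2.1 h1.2.1 h2.2.1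

/-- The union of two overlaid pruned graphs. -/
def overlayGraph (F₁ F₂ : Finset (Sym2 M)) (φ₁ φ₂ : V → M) : SimpleGraph V where
  Adj u v := OverlayAdj F₁ F₂ φ₁ φ₂ u v ∨ OverlayAdj F₂ F₁ φ₂ φ₁ u v
  symm := ⟨fun _ _ h => h.imp OverlayAdj.symm OverlayAdj.symm⟩
  loopless := ⟨fun _ h => h.elim (fun h => h.1 rfl) fun h => h.1 rfl⟩

theorem overlayGraph_cliqueFree (F₁ F₂ : Finset (Sym2 M)) (φ₁ φ₂ : V → M) :
    (overlayGraph F₁ F₂ φ₁ φ₂).CliqueFree 3 := by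
  classical
  intro T hT
  obtain ⟨u, v, w, huv, huw, hvw, -⟩ := is3Clique_iff.1 hT
  rcases huv with huv | huv <;> rcases huw with huw | huw <;> rcases hvw with hvw | hvw
  · exact huv.not_triangle huw hvw
  · exact hvw.not_path huv.symm huw.symm
  · exact huw.not_path huv hvw.symm
  · exact huv.not_path huw hvw
  · exact huv.not_path huw hvw
  · exact huw.not_path huv hvw.symm
  · exact hvw.not_path huv.symm huw.symm
  · exact huv.not_triangle huw hvw

/-- The pseudorandomness conditions on a graph used in the overlay construction. -/
def IsPseudoRandom (F : Finset (Sym2 M)) (x₀ q Δ : ℝ) (D D' L : ℕ) : Prop :=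
  LocallySparse F x₀ D L ∧ LocallySparse F q D' L ∧ DegreesLE F Δ

open Classical in
/-- The images in the first graph of the pairs of `J` that are not closed in the second. -/
noncomputable def openPairs (F : Finset (Sym2 M)) (φ₁ φ₂ : V → M) (J : Finset V) :
    Finset (Sym2 M) :=
  {v ∈ J ×ˢ J | ¬ (φ₂ v.1 = φ₂ v.2 ∨ HasCommonNbr F (φ₂ v.1) (φ₂ v.2))}.image
    fun v => s(φ₁ v.1, φ₁ v.2)

theorem exists_overlayAdj {F₁ F₂ : Finset (Sym2 M)} {φ₁ φ₂ : V → M} {J : Finset V}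
    (hinj : Set.InjOn φ₁ J) (h : ¬ Disjoint (openPairs F₂ φ₁ φ₂ J) (trianglePrune F₁)) :
    ∃ u ∈ J, ∃ v ∈ J, OverlayAdj F₁ F₂ φ₁ φ₂ u v := by
  classical
  obtain ⟨e, he, heF⟩ := not_disjoint_iff.1 h
  obtain ⟨⟨u, v⟩, huv, rfl⟩ := mem_image.1 he
  simp only [mem_filter, mem_product, not_or] at huv
  obtain ⟨⟨hu, hv⟩, hne, hcl⟩ := huv
  exact ⟨u, hu, v, hv, fun h => hne (congrArg φ₂ (hinj hu hv h)), heF, hne, hcl⟩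

theorem card_openPairs_ge {F : Finset (Sym2 M)} {x₀ Δ : ℝ} {q t τ D D' L : ℕ}
    (hF : IsPseudoRandom F x₀ q Δ D D' L) (ht : 0 < t) (hx₀ : (q : ℝ) / t ≤ x₀)
    (hK : τ * (1 + Δ * (D + L)) ≤ q / 4) (hK' : t * (1 + Δ * (D' + L)) ≤ q / 4)
    {φ₁ φ₂ : V → M} {J : Finset V} (hJ : #J = q) (hinj : Set.InjOn φ₁ J)
    (hfib : ∀ a, #{v ∈ J | φ₂ v = a} ≤ τ) :
    (q : ℝ) ^ 2 / 16 ≤ #(openPairs F φ₁ φ₂ J) := by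
  classical
  have hsparse : ∀ {y : ℝ} {E : ℕ}, LocallySparse F y E L → ∀ X : Finset M, (#X : ℝ) ≤ y →
      (#{x ∈ X ×ˢ X | x.1 = x.2 ∨ HasCommonNbr F x.1 x.2} : ℝ) ≤ (1 + Δ * (E + L)) * #X := by
    intro y E hE X hX
    have h1 := card_hasCommonNbr_le hE hF.2.2 hX
    have h2 : #{x ∈ X ×ˢ X | x.1 = x.2} ≤ #X := by
      refine (card_le_card (t := X.image fun a => (a, a)) ?_).trans card_image_le
      rintro ⟨a, b⟩ hab
      simp only [mem_filter, mem_product] at hab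
      exact mem_image.2 ⟨a, hab.1.1, by rw [← hab.2]⟩
    have h3 : #{x ∈ X ×ˢ X | x.1 = x.2 ∨ HasCommonNbr F x.1 x.2} ≤
        #{x ∈ X ×ˢ X | x.1 = x.2} + #{x ∈ X ×ˢ X | HasCommonNbr F x.1 x.2} := by
      rw [filter_or]; exact card_union_le _ _
    have h4 : (#{x ∈ X ×ˢ X | x.1 = x.2 ∨ HasCommonNbr F x.1 x.2} : ℝ) ≤
        #X + #{x ∈ X ×ˢ X | HasCommonNbr F x.1 x.2} := by
      exact_mod_cast h3.trans (by gcongr)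
    linarith
  have h1 : (q : ℝ) ^ 2 / 8 ≤
      #{v ∈ J ×ˢ J | ¬ (φ₂ v.1 = φ₂ v.2 ∨ HasCommonNbr F (φ₂ v.1) (φ₂ v.2))} := by
    convert card_unrelated_ge (R := fun a b => a = b ∨ HasCommonNbr F a b) ht hx₀ hK hK'
      (fun X hX => by convert hsparse hF.1 X hX) (fun X hX => by convert hsparse hF.2.1 X hX)
      φ₂ hJ hfib
  have h2 : #{v ∈ J ×ˢ J | ¬ (φ₂ v.1 = φ₂ v.2 ∨ HasCommonNbr F (φ₂ v.1) (φ₂ v.2))} ≤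
      2 * #(openPairs F φ₁ φ₂ J) := by
    refine card_le_mul_card_image _ 2 fun e he => ?_
    obtain ⟨⟨u, v⟩, huv, rfl⟩ := mem_image.1 he
    simp only [mem_filter, mem_product] at huv
    refine (card_le_card (t := {(u, v), (v, u)}) ?_).trans card_le_two
    rintro ⟨x, y⟩ hxy
    simp only [mem_filter, mem_product, Sym2.eq_iff] at hxy
    simp only [mem_insert, mem_singleton, Prod.mk.injEq]
    obtain ⟨⟨⟨hx, hy⟩, -⟩, ⟨h1, h2⟩ | ⟨h1, h2⟩⟩ := hxy
    · exact Or.inl ⟨hinj hx huv.1.1 h1, hinj hy huv.1.2 h2⟩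
    · exact Or.inr ⟨hinj hx huv.1.2 h1, hinj hy huv.1.1 h2⟩
  have h3 : (#{v ∈ J ×ˢ J | ¬ (φ₂ v.1 = φ₂ v.2 ∨ HasCommonNbr F (φ₂ v.1) (φ₂ v.2))} : ℝ) ≤
      2 * #(openPairs F φ₁ φ₂ J) := by exact_mod_cast h2
  linarith

/-- If the second graph is pseudorandom, then the first is likely to have an open edge in every
large set on which the first projection is injective. -/
theorem bernoulliProb_exists_disjoint_le {p : ℝ} (h0 : 0 ≤ p) (h1 : p ≤ 1 / 2)
    (hp : Fintype.card M * p ^ 2 ≤ 1 / 16) {F : Finset (Sym2 M)} {x₀ Δ : ℝ} {q t τ D D' L : ℕ}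
    (hF : IsPseudoRandom F x₀ q Δ D D' L) (ht : 0 < t) (hx₀ : (q : ℝ) / t ≤ x₀)
    (hK : τ * (1 + Δ * (D + L)) ≤ q / 4) (hK' : t * (1 + Δ * (D' + L)) ≤ q / 4)
    [Fintype V] [DecidableEq V] {φ₁ φ₂ : V → M} {B : Finset V}
    (hfib : ∀ a, #{v ∈ B | φ₂ v = a} ≤ τ)
    (hV : (Fintype.card V : ℝ) ^ q * Real.exp (-(p * q ^ 2 / 32)) ≤ 1 / 16) :
    bernoulliProb p (fun F₁ => ∃ J ⊆ B, #J = q ∧ Set.InjOn φ₁ J ∧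
      Disjoint (openPairs F φ₁ φ₂ J) (trianglePrune F₁)) ≤ 1 / 16 := by
  classical
  refine le_trans (bernoulliProb_mono h0 (by linarith) (Q := fun F₁ => ∃ J ∈
      ((univ : Finset V).powersetCard q).filter (fun J => J ⊆ B ∧ Set.InjOn φ₁ J),
      Disjoint (openPairs F φ₁ φ₂ J) (trianglePrune F₁)) ?_)
    ((bernoulliProb_exists_le h0 (by linarith) _ _).trans ?_)
  · rintro F₁ ⟨J, hJB, hJ, hinj, hd⟩
    exact ⟨J, by simp [mem_powersetCard, hJ, hJB, hinj], hd⟩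
  · calc _ ≤ ∑ J ∈ ((univ : Finset V).powersetCard q).filter (fun J => J ⊆ B ∧ Set.InjOn φ₁ J),
          Real.exp (-(p * q ^ 2 / 32)) := by
          refine sum_le_sum fun J hJ => ?_
          simp only [mem_filter, mem_powersetCard] at hJ
          obtain ⟨⟨-, hJ⟩, hJB, hinj⟩ := hJ
          refine (bernoulliProb_disjoint_trianglePrune_le h0 h1 hp _).trans ?_
          have := card_openPairs_ge hF ht hx₀ hK hK' hJ hinj fun a =>
            (card_le_card (filter_subset_filter _ hJB)).trans (hfib a)
          have := mul_le_mul_of_nonneg_left this h0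
          apply Real.exp_le_exp.2
          linarith
      _ ≤ ∑ J ∈ (univ : Finset V).powersetCard q, Real.exp (-(p * q ^ 2 / 32)) :=
          sum_le_sum_of_subset_of_nonneg (filter_subset _ _) fun _ _ _ => (Real.exp_pos _).le
      _ = (Fintype.card V).choose q * Real.exp (-(p * q ^ 2 / 32)) := by
          simp
      _ ≤ (Fintype.card V : ℝ) ^ q * Real.exp (-(p * q ^ 2 / 32)) := by
          gcongr
          exact_mod_cast Nat.choose_le_pow _ _
      _ ≤ _ := hV

end Overlay

section Incidence

variable {M : Type*} [Fintype M] [DecidableEq M]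

theorem bernoulliProb_card_ge_le {α : Type*} [Fintype α] [DecidableEq α] {p : ℝ} (h0 : 0 ≤ p)
    (h1 : p ≤ 1) (T : Finset α) (θ j : ℝ) :
    bernoulliProb p (fun B => θ * j ≤ θ * #(B ∩ T)) ≤
      Real.exp (-(θ * j) + p * (#T * (Real.exp θ - 1))) := by
  have h := bernoulliProb_le_exp h0 h1 (fun e => if e ∈ T then θ else 0) (θ * j)
  have e1 : ∀ B : Finset α, ∑ e ∈ B, (if e ∈ T then θ else 0) = θ * #(B ∩ T) := by
    intro B
    rw [← sum_filter, filter_mem_eq_inter, sum_const, nsmul_eq_mul, mul_comm]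
  have e2 : ∑ e, (Real.exp (if e ∈ T then θ else 0) - 1) = #T * (Real.exp θ - 1) := by
    have : ∀ e, Real.exp (if e ∈ T then θ else 0) - 1 = if e ∈ T then Real.exp θ - 1 else 0 := by
      intro e; split_ifs <;> simp
    simp_rw [this]
    rw [← sum_filter, filter_mem_eq_inter, univ_inter, sum_const, nsmul_eq_mul]
  simp only [e1, e2] at h
  exact h

/-- There is an incidence set on `M × M` of the expected size, whose fibres are not much larger
than expected, and which has few points in every small box. -/
theorem exists_incidence {p θ τ : ℝ} {q : ℕ} (h0 : 0 ≤ p) (h1 : p ≤ 1) (hq : 1 ≤ q) (hθ : 0 < θ)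
    (hτ : 6 * (p * Fintype.card M) ≤ τ)
    (hfib : Fintype.card M * Real.exp (-(4 * (p * Fintype.card M))) ≤ 1 / 8)
    (hsize : Real.exp (-(p * Fintype.card M ^ 2 / 10)) ≤ 1 / 4)
    (hbox : p * q * Real.exp θ ≤ 1)
    (hbox' : (Fintype.card M : ℝ) ^ 2 * Real.exp (1 - 8 * θ) ≤ 1 / 8) :
    ∃ B : Finset (M × M), p * Fintype.card M ^ 2 / 2 ≤ #B ∧
      (∀ a, (#{v ∈ B | v.1 = a} : ℝ) ≤ τ) ∧ (∀ a, (#{v ∈ B | v.2 = a} : ℝ) ≤ τ) ∧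
      ∀ A A' : Finset M, #A = q → #A' = q → #{v ∈ B | v.1 ∈ A ∧ v.2 ∈ A'} < 8 * q := by
  classical
  set m := Fintype.card M with hm
  have hfibre : ∀ T : Finset (M × M), #T = m →
      bernoulliProb p (fun B => τ ≤ #(B ∩ T)) ≤ Real.exp (-(4 * (p * m))) := by
    intro T hT
    have h := bernoulliProb_card_ge_le h0 h1 T 1 τ
    simp only [one_mul, hT] at h
    refine h.trans (Real.exp_le_exp.2 ?_)
    have h3 : Real.exp 1 - 1 ≤ 2 := by linarith [Real.exp_one_lt_d9]
    have h4 : 0 ≤ p * m := by positivity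
    nlinarith
  have hrow : ∀ T : M → Finset (M × M), (∀ a, #(T a) = m) →
      bernoulliProb p (fun B => ∃ a ∈ univ, τ ≤ #(B ∩ T a)) ≤ 1 / 8 := by
    intro T hT
    refine (bernoulliProb_exists_le h0 h1 _ _).trans
      ((sum_le_sum fun a _ => hfibre _ (hT a)).trans ?_)
    simpa using hfib
  have hr1 := hrow (fun a => {v | v.1 = a}) fun a => by
    have : ({v : M × M | v.1 = a} : Finset (M × M)) = {a} ×ˢ univ := by ext ⟨x, y⟩; simp [eq_comm]
    rw [this, card_product]; simp [hm]
  have hr2 := hrow (fun a => {v | v.2 = a}) fun a => by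
    have : ({v : M × M | v.2 = a} : Finset (M × M)) = univ ×ˢ {a} := by ext ⟨x, y⟩; simp [eq_comm]
    rw [this, card_product]; simp [hm]
  have hsz : bernoulliProb p (fun B : Finset (M × M) => (#B : ℝ) ≤ p * m ^ 2 / 2) ≤ 1 / 4 := by
    have h := bernoulliProb_card_ge_le h0 h1 (univ : Finset (M × M)) (-1) (p * m ^ 2 / 2)
    simp only [inter_univ, neg_mul, one_mul, neg_le_neg_iff, card_univ, Fintype.card_prod,
      Nat.cast_mul, neg_neg] at h
    refine h.trans ((Real.exp_le_exp.2 ?_).trans hsize)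
    have h3 : Real.exp (-1) ≤ 0.37 := by
      rw [Real.exp_neg, inv_le_comm₀ (Real.exp_pos _) (by norm_num)]
      exact le_trans (by norm_num) Real.exp_one_gt_d9.le
    have h4 : 0 ≤ p * (m : ℝ) ^ 2 := by positivity
    rw [← hm]
    nlinarith
  have hbx : bernoulliProb p (fun B : Finset (M × M) => ∃ A ∈ (univ : Finset M).powersetCard q ×ˢ
      (univ : Finset M).powersetCard q, θ * (8 * q) ≤ θ * #(B ∩ A.1 ×ˢ A.2)) ≤ 1 / 8 := by
    refine (bernoulliProb_exists_le h0 h1 _ _).trans ?_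
    have hone : ∀ A ∈ (univ : Finset M).powersetCard q ×ˢ (univ : Finset M).powersetCard q,
        bernoulliProb p (fun B : Finset (M × M) => θ * (8 * q) ≤ θ * #(B ∩ A.1 ×ˢ A.2)) ≤
          Real.exp (1 - 8 * θ) ^ q := by
      rintro ⟨A, A'⟩ hA
      simp only [mem_product, mem_powersetCard] at hA
      refine (bernoulliProb_card_ge_le h0 h1 _ _ _).trans ?_
      rw [← Real.exp_nat_mul]
      apply Real.exp_le_exp.2
      rw [card_product, hA.1.2, hA.2.2]
      push_cast
      have h5 := mul_le_mul_of_nonneg_left hbox (Nat.cast_nonneg (α := ℝ) q)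
      have h6 : 0 ≤ p * (q * q : ℝ) := by positivity
      nlinarith
    refine (sum_le_sum hone).trans ?_
    rw [sum_const, nsmul_eq_mul, card_product, card_powersetCard, card_univ, ← hm]
    have h7 : ((m.choose q * m.choose q : ℕ) : ℝ) ≤ ((m : ℝ) ^ 2) ^ q := by
      have := Nat.mul_le_mul (Nat.choose_le_pow m q) (Nat.choose_le_pow m q)
      rw [← mul_pow] at this
      rw [sq]
      exact_mod_cast this
    calc _ ≤ ((m : ℝ) ^ 2) ^ q * Real.exp (1 - 8 * θ) ^ q := by gcongr
      _ = ((m : ℝ) ^ 2 * Real.exp (1 - 8 * θ)) ^ q := (mul_pow _ _ _).symm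
      _ ≤ (1 / 8 : ℝ) ^ q := by gcongr
      _ ≤ (1 / 8 : ℝ) ^ 1 := pow_le_pow_of_le_one (by norm_num) (by norm_num) hq
      _ = 1 / 8 := pow_one _
  obtain ⟨B, hB⟩ := exists_not_of_bernoulliProb_lt_one (p := p) (P := fun B : Finset (M × M) =>
    ((∃ a ∈ univ, τ ≤ #(B ∩ ({v | v.1 = a} : Finset (M × M)))) ∨
      (∃ a ∈ univ, τ ≤ #(B ∩ ({v | v.2 = a} : Finset (M × M))))) ∨
    ((#B : ℝ) ≤ p * m ^ 2 / 2 ∨ (∃ A ∈ (univ : Finset M).powersetCard q ×ˢ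
      (univ : Finset M).powersetCard q, θ * (8 * q) ≤ θ * #(B ∩ A.1 ×ˢ A.2)))) (by
    have a1 := bernoulliProb_or_le h0 h1 (fun B : Finset (M × M) =>
      (∃ a ∈ univ, τ ≤ #(B ∩ ({v | v.1 = a} : Finset (M × M)))) ∨
      (∃ a ∈ univ, τ ≤ #(B ∩ ({v | v.2 = a} : Finset (M × M))))) (fun B => (#B : ℝ) ≤ p * m ^ 2 / 2 ∨ (∃ A ∈ (univ : Finset M).powersetCard q ×ˢ
      (univ : Finset M).powersetCard q, θ * (8 * q) ≤ θ * #(B ∩ A.1 ×ˢ A.2)))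
    have a2 := bernoulliProb_or_le h0 h1 (fun B : Finset (M × M) =>
      (∃ a ∈ univ, τ ≤ #(B ∩ ({v | v.1 = a} : Finset (M × M))))) (fun B =>
      (∃ a ∈ univ, τ ≤ #(B ∩ ({v | v.2 = a} : Finset (M × M)))))
    have a3 := bernoulliProb_or_le h0 h1 (fun B : Finset (M × M) => (#B : ℝ) ≤ p * m ^ 2 / 2)
      (fun B => (∃ A ∈ (univ : Finset M).powersetCard q ×ˢ
      (univ : Finset M).powersetCard q, θ * (8 * q) ≤ θ * #(B ∩ A.1 ×ˢ A.2)))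
    linarith)
  simp only [not_or, not_exists, not_and, not_le, mem_univ, true_imp_iff] at hB
  obtain ⟨⟨b1, b2⟩, b3, b4⟩ := hB
  refine ⟨B, b3.le, fun a => ?_, fun a => ?_, fun A A' hA hA' => ?_⟩
  · refine le_trans ?_ (b1 a).le
    exact_mod_cast card_le_card fun v hv => by simpa using hv
  · refine le_trans ?_ (b2 a).le
    exact_mod_cast card_le_card fun v hv => by simpa using hv
  · have := lt_of_mul_lt_mul_left (b4 (A, A') (by simp [mem_powersetCard, hA, hA'])) hθ.le
    have h8 : ({v ∈ B | v.1 ∈ A ∧ v.2 ∈ A'} : Finset (M × M)) = B ∩ A ×ˢ A' := by ext; simp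
    rw [h8]
    exact_mod_cast this

/-- A subset of `B` with no point-set of size `q` injective under either projection is small. -/
theorem exists_injOn_of_card_ge {q : ℕ} (hq : q ≤ Fintype.card M) {B : Finset (M × M)}
    (hB : ∀ A A' : Finset M, #A = q → #A' = q → #{v ∈ B | v.1 ∈ A ∧ v.2 ∈ A'} < 8 * q)
    {I : Finset (M × M)} (hI : I ⊆ B) (hIq : 8 * q ≤ #I) :
    ∃ J ⊆ I, #J = q ∧ (Set.InjOn Prod.fst (J : Set (M × M)) ∨
      Set.InjOn Prod.snd (J : Set (M × M))) := by
  have key : ∀ φ : M × M → M, q ≤ #(I.image φ) → ∃ J ⊆ I, #J = q ∧ Set.InjOn φ (J : Set (M × M)) := by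
    intro φ hφ
    obtain ⟨A, hA, hAq⟩ := exists_subset_card_eq hφ
    have hsurj : Set.SurjOn φ I A := by
      rw [Set.SurjOn, ← coe_image]
      exact_mod_cast hA
    obtain ⟨J, hJI, hinj, hJA⟩ := exists_subset_injOn_image_eq_of_surjOn (I : Set (M × M)) A hsurj
    exact ⟨J, by exact_mod_cast hJI, by rw [← hAq, ← hJA, card_image_of_injOn hinj], hinj⟩
  by_cases h1 : q ≤ #(I.image Prod.fst)
  · obtain ⟨J, a, b, c⟩ := key _ h1
    exact ⟨J, a, b, Or.inl c⟩
  by_cases h2 : q ≤ #(I.image Prod.snd)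
  · obtain ⟨J, a, b, c⟩ := key _ h2
    exact ⟨J, a, b, Or.inr c⟩
  obtain ⟨A, hA, -, hAq⟩ := exists_subsuperset_card_eq (subset_univ _) (not_le.1 h1).le hq
  obtain ⟨A', hA', -, hAq'⟩ := exists_subsuperset_card_eq (subset_univ _) (not_le.1 h2).le hq
  have := hB A A' hAq hAq'
  have h3 : #I ≤ #{v ∈ B | v.1 ∈ A ∧ v.2 ∈ A'} := card_le_card fun v hv => mem_filter.2
    ⟨hI hv, hA (mem_image_of_mem _ hv), hA' (mem_image_of_mem _ hv)⟩
  omega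

/-- Two overlaid pruned random graphs restricted to an incidence set give a triangle-free graph
with no large independent set. -/
theorem exists_triangleFree_of_parameters {p x₀ Δ : ℝ} {q t τ D D' L : ℕ} {B : Finset (M × M)}
    (h0 : 0 ≤ p) (h1 : p ≤ 1 / 2) (hp : Fintype.card M * p ^ 2 ≤ 1 / 16)
    (hqM : q ≤ Fintype.card M)
    (hGood : bernoulliProb p (fun F : Finset (Sym2 M) => ¬ IsPseudoRandom F x₀ q Δ D D' L) ≤ 3 / 8)
    (ht : 0 < t) (hx₀ : (q : ℝ) / t ≤ x₀)
    (hK : τ * (1 + Δ * (D + L)) ≤ q / 4) (hK' : t * (1 + Δ * (D' + L)) ≤ q / 4)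
    (hV : ((Fintype.card M : ℝ) ^ 2) ^ q * Real.exp (-(p * q ^ 2 / 32)) ≤ 1 / 16)
    (hB1 : ∀ a, #{v ∈ B | v.1 = a} ≤ τ) (hB2 : ∀ a, #{v ∈ B | v.2 = a} ≤ τ)
    (hB : ∀ A A' : Finset M, #A = q → #A' = q → #{v ∈ B | v.1 ∈ A ∧ v.2 ∈ A'} < 8 * q) :
    ∃ G : SimpleGraph (M × M), G.CliqueFree 3 ∧
      ∀ I ⊆ B, 8 * q ≤ #I → ∃ u ∈ I, ∃ v ∈ I, G.Adj u v := by
  have hV' : (Fintype.card (M × M) : ℝ) ^ q * Real.exp (-(p * q ^ 2 / 32)) ≤ 1 / 16 := by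
    rw [Fintype.card_prod, Nat.cast_mul, ← sq]; exact hV
  obtain ⟨F₁, F₂, -, -, hP, hQ⟩ := exists_good_pair (α := Sym2 M) h0 (by linarith)
    (P := fun F₁ F₂ => ∃ J ⊆ B, #J = q ∧ Set.InjOn Prod.fst (J : Set (M × M)) ∧
      Disjoint (openPairs F₂ Prod.fst Prod.snd J) (trianglePrune F₁))
    (Q := fun F₁ F₂ => ∃ J ⊆ B, #J = q ∧ Set.InjOn Prod.snd (J : Set (M × M)) ∧
      Disjoint (openPairs F₁ Prod.snd Prod.fst J) (trianglePrune F₂)) hGood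
    (fun F₂ hF => bernoulliProb_exists_disjoint_le h0 h1 hp hF ht hx₀ hK hK' hB2 hV')
    (fun F₁ hF => bernoulliProb_exists_disjoint_le h0 h1 hp hF ht hx₀ hK hK' hB1 hV')
  refine ⟨overlayGraph F₁ F₂ Prod.fst Prod.snd, overlayGraph_cliqueFree _ _ _ _, fun I hI hIq => ?_⟩
  obtain ⟨J, hJI, hJq, hinj | hinj⟩ := exists_injOn_of_card_ge hqM hB hI hIq
  · obtain ⟨u, hu, v, hv, huv⟩ := exists_overlayAdj hinj
      fun hd => hP ⟨J, hJI.trans hI, hJq, hinj, hd⟩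
    exact ⟨u, hJI hu, v, hJI hv, Or.inl huv⟩
  · obtain ⟨u, hu, v, hv, huv⟩ := exists_overlayAdj hinj
      fun hd => hQ ⟨J, hJI.trans hI, hJq, hinj, hd⟩
    exact ⟨u, hJI hu, v, hJI hv, Or.inr huv⟩

end Incidence

set_option maxHeartbeats 1000000 in
/-- A triangle-free graph on at least `z ^ 100 / 2` vertices, all of whose independent sets have
size `O(√(log z) * z ^ 50)`. -/
theorem exists_triangleFree_graph {z : ℕ} (hz : 10 ^ 7 ≤ z) :
    ∃ (V : Type) (_ : Fintype V) (G : SimpleGraph V), (z : ℝ) ^ 100 / 2 ≤ Fintype.card V ∧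
      G.CliqueFree 3 ∧ Gᶜ.CliqueFree (8 * ⌈200000 * √(Real.log z) * (z : ℝ) ^ 50⌉₊) := by
  classical
  obtain ⟨Z, hZ⟩ : ∃ Z : ℝ, Z = z := ⟨_, rfl⟩
  obtain ⟨l, hl⟩ : ∃ l : ℝ, l = Real.log z := ⟨_, rfl⟩
  obtain ⟨y, hy⟩ : ∃ y : ℝ, y = √l := ⟨_, rfl⟩
  obtain ⟨q, hq⟩ : ∃ q : ℕ, q = ⌈200000 * √(Real.log z) * (z : ℝ) ^ 50⌉₊ := ⟨_, rfl⟩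
  rw [← hq, ← hZ]
  have hZ7 : (10 : ℝ) ^ 7 ≤ Z := by rw [hZ]; exact_mod_cast hz
  have hZ1 : 1 ≤ Z := le_trans (by norm_num) hZ7
  have hZ0 : 0 < Z := by linarith
  have hl1 : 1 ≤ l := by
    rw [hl, Real.le_log_iff_exp_le (by rw [← hZ]; exact hZ0), ← hZ]
    linarith [Real.exp_one_lt_d9]
  have hlZ : l ≤ Z := by rw [hl, ← hZ]; exact Real.log_le_self hZ0.le
  have hyl : y * y = l := by rw [hy]; exact Real.mul_self_sqrt (by linarith)
  have hy0 : 0 ≤ y := by rw [hy]; exact Real.sqrt_nonneg _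
  have hy1 : 1 ≤ y := by nlinarith
  have hyl' : y ≤ l := by nlinarith
  have hyZ : y ≤ Z := hyl'.trans hlZ
  have h100 : 100 * l ≤ Z ^ 2 := by nlinarith
  have hexp : ∀ k : ℕ, Real.exp (k * l) = Z ^ k := by
    intro k
    rw [Real.exp_nat_mul, hl, Real.exp_log (by rw [← hZ]; exact hZ0), hZ]
  have hexpn : ∀ k : ℕ, Real.exp (-(k * l)) = (Z ^ k)⁻¹ := by
    intro k; rw [Real.exp_neg, hexp]
  have hpw : ∀ a b : ℕ, a ≤ b → Z ^ a ≤ Z ^ b := fun a b h => pow_le_pow_right₀ hZ1 h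
  have hpos : ∀ a : ℕ, 0 < Z ^ a := fun a => pow_pos hZ0 a
  have hqx : q = ⌈200000 * y * Z ^ 50⌉₊ := by rw [hq, hy, hl, hZ]
  have hqlo : 200000 * y * Z ^ 50 ≤ q := by rw [hqx]; exact Nat.le_ceil _
  have hbig : 1 ≤ y * Z ^ 50 := one_le_mul_of_one_le_of_one_le hy1 (one_le_pow₀ hZ1)
  have hqhi : (q : ℝ) ≤ 400000 * y * Z ^ 50 := by
    rw [hqx]
    have := Nat.ceil_lt_add_one (a := 200000 * y * Z ^ 50) (by positivity)
    linarith
  have hq0 : (1 : ℝ) ≤ q := by linarith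
  obtain ⟨p, hp⟩ : ∃ p : ℝ, p = y / Z ^ 50 := ⟨_, rfl⟩
  have hpZ : p * Z ^ 50 = y := by rw [hp]; field_simp
  have hp0 : 0 ≤ p := by rw [hp]; positivity
  have hpqlo : 200000 * l ≤ p * q := by
    calc 200000 * l = p * (200000 * y * Z ^ 50) := by
          rw [← hyl]; linear_combination (-200000 * y) * hpZ
      _ ≤ p * q := by gcongr
  have hpqhi : p * q ≤ 400000 * l := by
    calc p * q ≤ p * (400000 * y * Z ^ 50) := by gcongr
      _ = 400000 * l := by rw [← hyl]; linear_combination (400000 * y) * hpZ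
  have hM : (Fintype.card (Fin (z ^ 93)) : ℝ) = Z ^ 93 := by rw [Fintype.card_fin, hZ]; push_cast; rfl
  have hpm : p * Z ^ 93 = y * Z ^ 43 := by rw [← hpZ]; ring
  -- smallness of `p`
  have hphalf : p ≤ 1 / 2 := by
    rw [hp, div_le_iff₀ (hpos _)]
    have := hpw 2 50 (by norm_num)
    nlinarith
  have hmp : Z ^ 93 * p ^ 2 ≤ 1 / 16 := by
    have h1 : Z ^ 93 * p ^ 2 * Z ^ 7 = l := by rw [← hyl, ← hpZ]; ring
    have h2 := hpw 2 7 (by norm_num)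
    by_contra! h
    nlinarith [mul_lt_mul_of_pos_right h (hpos 7)]
  -- small exponentials
  have hsmall : ∀ x : ℝ, 100 * l ≤ x → Z ^ 93 * Real.exp (-x) ≤ 1 / 32 := by
    intro x hx
    have h1 : Real.exp (-x) ≤ (Z ^ 100)⁻¹ := by
      rw [← hexpn]; apply Real.exp_le_exp.2; push_cast; linarith
    calc Z ^ 93 * Real.exp (-x) ≤ Z ^ 93 * (Z ^ 100)⁻¹ := by gcongr
      _ = (Z ^ 7)⁻¹ := by field_simp
      _ ≤ 1 / 32 := by
        rw [inv_le_comm₀ (hpos 7) (by norm_num)]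
        have := hpw 1 7 (by norm_num)
        linarith
  have hGood : bernoulliProb p (fun F : Finset (Sym2 (Fin (z ^ 93))) =>
      ¬ IsPseudoRandom F ((q : ℝ) / (z ^ 3 : ℕ)) q (10 * (y * Z ^ 43)) 400 (z ^ 3) 200) ≤ 3 / 8 := by
    have g1 := bernoulliProb_not_locallySparse_le (V := Fin (z ^ 93)) hp0 (by linarith)
      (x₀ := (q : ℝ) / (z ^ 3 : ℕ)) (θ := l) (by linarith) (D := 400) (L := 200) (by
        push_cast
        rw [← hZ, ← Nat.cast_ofNat (R := ℝ), hexp]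
        have : p * Z ^ 2 * (q / Z ^ 3) = p * q / Z := by field_simp
        rw [this, div_le_iff₀ hZ0]
        nlinarith) (by rw [hM]; exact hsmall _ (by push_cast; linarith))
      (by rw [hM]; exact (hsmall _ (by push_cast; linarith)).trans (by norm_num))
    have g2 := bernoulliProb_not_locallySparse_le (V := Fin (z ^ 93)) hp0 (by linarith)
      (x₀ := q) (θ := l) (by linarith) (D := z ^ 3) (L := 200) (by
        push_cast
        rw [← hZ, ← Nat.cast_ofNat (R := ℝ), hexp]
        have : p * Z ^ 2 * q = p * q * Z ^ 2 := by ring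
        rw [this]
        have h3 : l * Z ^ 3 / 4 = l * Z / 4 * Z ^ 2 := by ring
        rw [h3]
        have : p * q ≤ l * Z / 4 := by nlinarith
        gcongr) (by rw [hM]; exact hsmall _ (by push_cast; linarith))
      (by
        rw [hM]
        refine (hsmall _ ?_).trans (by norm_num)
        push_cast
        rw [← hZ]
        have h1 : 400 ≤ Z ^ 3 := le_trans (by linarith) (hpw 1 3 (by norm_num))
        have := mul_le_mul_of_nonneg_left h1 (by linarith : 0 ≤ l)
        linarith)
    have g3 := bernoulliProb_not_degreesLE_le (V := Fin (z ^ 93)) hp0 (by linarith)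
      (10 * (y * Z ^ 43))
    have g4 : (Fintype.card (Fin (z ^ 93)) : ℝ) * Real.exp (-(10 * (y * Z ^ 43)) +
        p * Real.exp 2 * Fintype.card (Fin (z ^ 93))) ≤ 1 / 8 := by
      rw [hM]
      have e2 : Real.exp 2 ≤ 8 := by
        have : Real.exp 2 = Real.exp 1 * Real.exp 1 := by rw [← Real.exp_add]; norm_num
        rw [this]
        nlinarith [Real.exp_one_lt_d9, Real.exp_pos 1]
      have h5 : p * Real.exp 2 * Z ^ 93 = Real.exp 2 * (y * Z ^ 43) := by rw [← hpm]; ring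
      have h6 : -(10 * (y * Z ^ 43)) + p * Real.exp 2 * Z ^ 93 =
          -((10 - Real.exp 2) * (y * Z ^ 43)) := by rw [h5]; ring
      rw [h6]
      refine (hsmall _ ?_).trans (by norm_num)
      have h7 := hpw 2 43 (by norm_num)
      have h8 : 100 * l ≤ y * Z ^ 43 := by
        have : Z ^ 43 ≤ y * Z ^ 43 := le_mul_of_one_le_left (hpos _).le hy1
        linarith
      have := mul_le_mul_of_nonneg_right (by linarith : 1 ≤ 10 - Real.exp 2)
        (by positivity : 0 ≤ y * Z ^ 43)
      linarith
    have g5 := bernoulliProb_or_le hp0 (by linarith) (fun F : Finset (Sym2 (Fin (z ^ 93))) =>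
      ¬ LocallySparse F ((q : ℝ) / (z ^ 3 : ℕ)) 400 200)
      (fun F => ¬ LocallySparse F q (z ^ 3) 200 ∨ ¬ DegreesLE F (10 * (y * Z ^ 43)))
    have g6 := bernoulliProb_or_le hp0 (by linarith) (fun F : Finset (Sym2 (Fin (z ^ 93))) =>
      ¬ LocallySparse F q (z ^ 3) 200) (fun F => ¬ DegreesLE F (10 * (y * Z ^ 43)))
    simp only [IsPseudoRandom, not_and_or]
    linarith
  -- the incidence set
  obtain ⟨p₀, hp₀⟩ : ∃ p₀ : ℝ, p₀ = (Z ^ 86)⁻¹ := ⟨_, rfl⟩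
  have hp₀Z : p₀ * Z ^ 86 = 1 := by rw [hp₀]; field_simp
  have hp₀0 : 0 ≤ p₀ := by rw [hp₀]; positivity
  have hp₀m : p₀ * Z ^ 93 = Z ^ 7 := by linear_combination Z ^ 7 * hp₀Z
  have hp₀m2 : p₀ * (Z ^ 93) ^ 2 = Z ^ 100 := by linear_combination Z ^ 100 * hp₀Z
  obtain ⟨B, hBsize, hB1, hB2, hB⟩ := exists_incidence (M := Fin (z ^ 93)) (p := p₀) (θ := 34 * l)
    (τ := (6 * z ^ 7 : ℕ)) (q := q) hp₀0 (by rw [hp₀]; exact inv_le_one_of_one_le₀ (one_le_pow₀ hZ1))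
    (by exact_mod_cast hq0) (by linarith) (by rw [hM, hp₀m, hZ]; push_cast; rfl)
    (by
      rw [hM, hp₀m]
      refine (hsmall _ ?_).trans (by norm_num)
      have := hpw 2 7 (by norm_num)
      linarith)
    (by
      rw [hM, hp₀m2]
      have h1 : Real.exp (-(Z ^ 100 / 10)) ≤ Real.exp (-((1 : ℕ) * l)) := by
        apply Real.exp_le_exp.2
        have := hpw 2 100 (by norm_num)
        push_cast
        linarith
      rw [hexpn] at h1
      refine h1.trans ?_
      rw [pow_one, inv_le_comm₀ hZ0 (by norm_num)]
      linarith)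
    (by
      have h34 : Real.exp (34 * l) = Z ^ 34 := by simpa using hexp 34
      rw [h34]
      calc p₀ * q * Z ^ 34 ≤ p₀ * (400000 * y * Z ^ 50) * Z ^ 34 := by gcongr
        _ = 400000 * y * (p₀ * Z ^ 84) := by ring
        _ ≤ Z ^ 2 * (p₀ * Z ^ 84) :=
          mul_le_mul_of_nonneg_right (by nlinarith) (mul_nonneg hp₀0 (hpos 84).le)
        _ = 1 := by rw [← hp₀Z]; ring)
    (by
      rw [hM]
      have h1 : Real.exp (1 - 8 * (34 * l)) = Real.exp 1 * (Z ^ 272)⁻¹ := by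
        rw [← hexpn, ← Real.exp_add]; push_cast; ring_nf
      rw [h1]
      have h2 : (Z ^ 93) ^ 2 * (Real.exp 1 * (Z ^ 272)⁻¹) = Real.exp 1 / Z ^ 86 := by
        field_simp
      rw [h2, div_le_iff₀ (hpos _)]
      have := hpw 1 86 (by norm_num)
      linarith [Real.exp_one_lt_d9])
  rw [hM, hp₀m2] at hBsize
  obtain ⟨G, hG3, hGI⟩ := exists_triangleFree_of_parameters (M := Fin (z ^ 93)) (q := q)
    (t := z ^ 3) (τ := 6 * z ^ 7) (B := B) hp0 hphalf (by rw [hM]; exact hmp)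
    (by
      have : (q : ℝ) ≤ Z ^ 93 := by
        refine hqhi.trans ?_
        have h1 : 400000 * y ≤ Z ^ 2 := by nlinarith
        calc 400000 * y * Z ^ 50 ≤ Z ^ 2 * Z ^ 50 := by gcongr
          _ = Z ^ 52 := by ring
          _ ≤ Z ^ 93 := hpw _ _ (by norm_num)
      rw [← hM] at this
      exact_mod_cast this) hGood (pow_pos (by omega) 3) le_rfl
    (by
      push_cast
      rw [← hZ]
      have h1 : Z ^ 7 ≤ y * Z ^ 50 := (hpw 7 50 (by norm_num)).trans
        (le_mul_of_one_le_left (hpos _).le hy1)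
      have h2 : 6 * Z ^ 7 * (1 + 10 * (y * Z ^ 43) * (400 + 200)) =
        6 * Z ^ 7 + 36000 * (y * Z ^ 50) := by ring
      rw [h2]
      linarith)
    (by
      push_cast
      rw [← hZ]
      have h1 : Z ^ 3 * (1 + 10 * (y * Z ^ 43) * (Z ^ 3 + 200)) =
        Z ^ 3 + 10 * (y * Z ^ 49) + 2000 * (y * Z ^ 46) := by ring
      have h2 : ∀ a ≤ 50, y * Z ^ a ≤ y * Z ^ 50 := fun a ha => by have := hpw a 50 ha; gcongr
      have h3 : Z ^ 3 ≤ y * Z ^ 50 := (hpw 3 50 (by norm_num)).trans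
        (le_mul_of_one_le_left (hpos _).le hy1)
      rw [h1]
      linarith [h2 49 (by norm_num), h2 46 (by norm_num)])
    (by
      rw [hM]
      have h1 : ((Z ^ 93) ^ 2) ^ q = Real.exp (186 * l * q) := by
        rw [← pow_mul, ← hexp, ← Real.exp_nat_mul]
        push_cast
        ring_nf
      rw [h1, ← Real.exp_add]
      have h2 : 186 * l * q + -(p * q ^ 2 / 32) ≤ -((1 : ℕ) * l) := by
        have : 200000 * l * q ≤ p * q ^ 2 := by
          rw [sq, ← mul_assoc]; gcongr
        push_cast
        nlinarith
      refine (Real.exp_le_exp.2 h2).trans ?_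
      rw [hexpn, pow_one, inv_le_comm₀ hZ0 (by norm_num)]
      linarith) (fun a => by exact_mod_cast hB1 a) (fun a => by exact_mod_cast hB2 a) hB
  refine ⟨B, inferInstance, G.comap Subtype.val, by simpa using hBsize, ?_, ?_⟩
  · exact hG3.comap ⟨(SimpleGraph.Embedding.comap (Function.Embedding.subtype _) G).toCopy⟩
  intro s hs
  obtain ⟨u, hu, v, hv, huv⟩ := hGI (s.map (Function.Embedding.subtype _))
    (fun x hx => by obtain ⟨a, -, rfl⟩ := mem_map.1 hx; exact a.2) (by rw [card_map, hs.card_eq])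
  obtain ⟨a, ha, rfl⟩ := mem_map.1 hu
  obtain ⟨b, hb, rfl⟩ := mem_map.1 hv
  have hab : a ≠ b := fun h => by subst h; exact huv.ne rfl
  exact (hs.isClique ha hb hab).2 huv

theorem sum_powerset_card_eq {α : Type*} [DecidableEq α] (U : Finset α) :
    ∑ T ∈ U.powerset, (#T : ℝ) = #U * 2 ^ #U / 2 := by
  have h1 : ∑ T ∈ U.powerset, (#T : ℝ) = ∑ T ∈ U.powerset, (#(U \ T) : ℝ) :=
    sum_nbij' (fun T => U \ T) (fun T => U \ T) (by simp) (by simp)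
      (fun T hT => Finset.sdiff_sdiff_eq_self (mem_powerset.1 hT))
      (fun T hT => Finset.sdiff_sdiff_eq_self (mem_powerset.1 hT))
      (fun T hT => by rw [Finset.sdiff_sdiff_eq_self (mem_powerset.1 hT)])
  have h2 : ∑ T ∈ U.powerset, ((#T : ℝ) + #(U \ T)) = 2 ^ #U * #U := by
    rw [sum_congr rfl (g := fun _ => (#U : ℝ)), sum_const, card_powerset, nsmul_eq_mul]
    · push_cast; rfl
    · intro T hT
      have := card_sdiff_add_card_eq_card (mem_powerset.1 hT)
      rw [← this]; push_cast; ring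
  rw [sum_add_distrib, ← h1] at h2
  linarith

/-- The weighted average of the number of neighbours in a random independent set is at least of
order `log d`, whatever the number `x` of available neighbours. -/
theorem log_div_mul_le_add {d : ℝ} (hd : 1 ≤ d) (x : ℕ) :
    Real.log d / 8 * (1 + 2 ^ x) ≤ d + x * 2 ^ x / 2 := by
  have hlog : 0 ≤ Real.log d := Real.log_nonneg hd
  have hs1 : 1 ≤ √d := Real.one_le_sqrt.2 hd
  have hss : √d * √d = d := Real.mul_self_sqrt (by linarith)
  have hlogs : Real.log d = 2 * Real.log √d := by
    rw [Real.log_sqrt (by linarith)]; ring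
  have hlogle : Real.log √d ≤ √d := Real.log_le_self (by linarith)
  have h2 : (1 : ℝ) ≤ 2 ^ x := one_le_pow₀ (by norm_num)
  rcases le_total ((2 : ℝ) ^ x) √d with h | h
  · have : (0 : ℝ) ≤ x * 2 ^ x / 2 := by positivity
    have h3 : Real.log d / 8 * (1 + 2 ^ x) ≤ √d / 4 * (2 * √d) := by
      apply mul_le_mul <;> linarith
    nlinarith
  · have h3 : Real.log √d ≤ x := by
      have h4 := Real.log_le_log (by linarith) h
      rw [Real.log_pow] at h4
      have h5 : Real.log 2 ≤ 1 := by linarith [Real.log_two_lt_d9]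
      have : (x : ℝ) * Real.log 2 ≤ x := mul_le_of_le_one_right (Nat.cast_nonneg x) h5
      linarith
    nlinarith

section IndepSets

variable {V : Type*} [Fintype V] [DecidableEq V] {G : SimpleGraph V} [DecidableRel G.Adj]

open Classical in
theorem sum_indepSets_ge (h3 : G.CliqueFree 3) (v : V) {d : ℝ} (hd : 1 ≤ d) :
    ∑ _I ∈ ({I | G.IsIndepSet I} : Finset (Finset V)), Real.log d / 8 ≤
      ∑ I ∈ ({I | G.IsIndepSet I} : Finset (Finset V)),
        ((if v ∈ I then d else 0) + #(G.neighborFinset v ∩ I)) := by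
  set N := G.neighborFinset v with hN
  rw [← sum_fiberwise _ (fun I => I \ insert v N),
    ← sum_fiberwise _ (fun I => I \ insert v N) (fun I => (if v ∈ I then d else 0) + (#(N ∩ I) : ℝ))]
  refine sum_le_sum fun J _ => ?_
  rcases (filter (fun I => I \ insert v N = J)
    ({I | G.IsIndepSet I} : Finset (Finset V))).eq_empty_or_nonempty with he | ⟨I₀, hI₀⟩
  · rw [he]; simp
  simp only [mem_filter, mem_univ, true_and] at hI₀
  obtain ⟨hI₀, hJ⟩ := hI₀
  have hJI : J ⊆ I₀ := hJ ▸ sdiff_subset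
  have hJind : G.IsIndepSet J := fun a ha b hb hab => hI₀ (hJI ha) (hJI hb) hab
  have hvJ : v ∉ J := by rw [← hJ]; simp
  have hNJ : ∀ u ∈ J, u ∉ N := by
    intro u hu huN
    rw [← hJ] at hu
    simp [huN] at hu
  have hvN : v ∉ N := by simp [hN]
  set U := {u ∈ N | ∀ j ∈ J, ¬ G.Adj u j} with hU
  have hUN : U ⊆ N := filter_subset _ _
  have hNind := isIndepSet_neighborSet_of_triangleFree G h3 v
  have hfib : filter (fun I => I \ insert v N = J) ({I | G.IsIndepSet I} : Finset (Finset V)) =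
      insert (insert v J) (U.powerset.image (J ∪ ·)) := by
    ext I
    simp only [mem_filter, mem_univ, true_and, mem_insert, mem_image, mem_powerset]
    constructor
    · rintro ⟨hI, hIJ⟩
      have hJ' : J ⊆ I := hIJ ▸ sdiff_subset
      by_cases hv : v ∈ I
      · left
        ext a
        rw [mem_insert]
        constructor
        · intro ha
          by_cases hav : a = v
          · exact Or.inl hav
          · right
            rw [← hIJ, mem_sdiff, mem_insert, not_or]
            refine ⟨ha, hav, fun haN => ?_⟩
            rw [hN, mem_neighborFinset] at haN
            exact hI hv ha (Ne.symm hav) haN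
        · rintro (rfl | ha)
          · exact hv
          · exact hJ' ha
      · right
        refine ⟨I ∩ N, ?_, ?_⟩
        · intro a ha
          rw [mem_inter] at ha
          refine mem_filter.2 ⟨ha.2, fun j hj hadj => ?_⟩
          exact hI ha.1 (hJ' hj) hadj.ne hadj
        · ext a
          rw [mem_union, ← hIJ, mem_sdiff, mem_insert, mem_inter]
          constructor
          · tauto
          · intro ha
            by_cases haN : a ∈ N
            · exact Or.inr ⟨ha, haN⟩
            · refine Or.inl ⟨ha, ?_⟩
              rintro (rfl | h)
              · exact hv ha
              · exact haN h
    · rintro (rfl | ⟨T, hT, rfl⟩)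
      · constructor
        · have hadj : ∀ b ∈ J, ¬ G.Adj v b := by
            intro b hb h
            exact hNJ b hb (by rw [hN, mem_neighborFinset]; exact h)
          intro a ha b hb hab
          simp only [coe_insert, Set.mem_insert_iff, mem_coe] at ha hb
          rcases ha with rfl | ha <;> rcases hb with rfl | hb
          · exact absurd rfl hab
          · exact hadj b hb
          · exact fun h => hadj a ha h.symm
          · exact hJind ha hb hab
        · ext a
          simp only [mem_sdiff, mem_insert, not_or]
          constructor
          · rintro ⟨rfl | ha, h1, h2⟩
            · exact absurd rfl h1
            · exact ha
          · intro ha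
            exact ⟨Or.inr ha, fun h => hvJ (h ▸ ha), hNJ a ha⟩
      · constructor
        · intro a ha b hb hab
          simp only [coe_union, Set.mem_union, mem_coe] at ha hb
          rcases ha with ha | ha <;> rcases hb with hb | hb
          · exact hJind ha hb hab
          · exact fun h => (mem_filter.1 (hT hb)).2 a ha h.symm
          · exact (mem_filter.1 (hT ha)).2 b hb
          · have h1 := hUN (hT ha)
            have h2 := hUN (hT hb)
            rw [hN, mem_neighborFinset] at h1 h2
            exact hNind h1 h2 hab
        · ext a
          simp only [mem_sdiff, mem_union, mem_insert, not_or]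
          constructor
          · rintro ⟨ha | ha, h1, h2⟩
            · exact ha
            · exact absurd (hUN (hT ha)) h2
          · intro ha
            exact ⟨Or.inl ha, fun h => hvJ (h ▸ ha), hNJ a ha⟩
  have hnot : insert v J ∉ U.powerset.image (J ∪ ·) := by
    intro h
    obtain ⟨T, hT, hTv⟩ := mem_image.1 h
    have : v ∈ J ∪ T := hTv ▸ mem_insert_self v J
    rcases mem_union.1 this with h | h
    · exact hvJ h
    · exact hvN (hUN (mem_powerset.1 hT h))
  have hNT : ∀ T ⊆ U, N ∩ (J ∪ T) = T := by
    intro T hT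
    ext a
    simp only [mem_inter, mem_union]
    constructor
    · rintro ⟨h1, h2 | h2⟩
      · exact absurd h1 (hNJ a h2)
      · exact h2
    · intro ha
      exact ⟨hUN (hT ha), Or.inr ha⟩
  have hinj : Set.InjOn (J ∪ ·) (U.powerset : Set (Finset V)) := by
    intro T hT T' hT' h
    simp only [coe_powerset, Set.mem_preimage, Set.mem_powerset_iff, coe_subset] at hT hT'
    rw [← hNT T hT, ← hNT T' hT']
    exact congrArg (N ∩ ·) h
  rw [hfib, sum_insert hnot, sum_insert hnot, sum_image hinj, sum_image hinj]
  have e1 : ∑ T ∈ U.powerset, ((if v ∈ J ∪ T then d else 0) + (#(N ∩ (J ∪ T)) : ℝ)) =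
      #U * 2 ^ #U / 2 := by
    rw [← sum_powerset_card_eq]
    refine sum_congr rfl fun T hT => ?_
    rw [mem_powerset] at hT
    rw [hNT T hT, if_neg, zero_add]
    intro h
    rcases mem_union.1 h with h | h
    · exact hvJ h
    · exact hvN (hUN (hT h))
  rw [e1, sum_const, card_powerset, if_pos (mem_insert_self _ _), nsmul_eq_mul]
  have := log_div_mul_le_add hd #U
  have h0 : (0 : ℝ) ≤ #(N ∩ insert v J) := Nat.cast_nonneg _
  push_cast
  linarith

/-- A triangle-free graph with no independent set of size `n` has `O(n ^ 2 / log n)` vertices. -/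
theorem card_mul_log_le (h3 : G.CliqueFree 3) {n : ℕ} (hn : 1 ≤ n) (hc : Gᶜ.CliqueFree n) :
    Fintype.card V * Real.log n ≤ 16 * n ^ 2 := by
  classical
  have hind : ∀ I : Finset V, G.IsIndepSet I → #I ≤ n := by
    intro I hI
    by_contra! h
    obtain ⟨J, hJI, hJ⟩ := exists_subset_card_eq h.le
    exact hc J ⟨(isClique_compl (G := G)).2 (hI.mono hJI), hJ⟩
  have hdeg : ∀ v, G.degree v ≤ n := by
    intro v
    refine hind _ ?_
    rw [coe_neighborFinset]
    exact isIndepSet_neighborSet_of_triangleFree G h3 v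
  set S : Finset (Finset V) := {I | G.IsIndepSet I} with hS
  have hne : S.Nonempty := ⟨∅, by simp [hS, SimpleGraph.IsIndepSet]⟩
  have h1 : ∑ v : V, ∑ _I ∈ S, Real.log n / 8 ≤
      ∑ v : V, ∑ I ∈ S, ((if v ∈ I then (n : ℝ) else 0) + #(G.neighborFinset v ∩ I)) :=
    sum_le_sum fun v _ => by
      convert sum_indepSets_ge h3 v (d := n) (by exact_mod_cast hn)
  have h2 : ∑ v : V, ∑ I ∈ S, ((if v ∈ I then (n : ℝ) else 0) + #(G.neighborFinset v ∩ I)) ≤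
      ∑ _I ∈ S, 2 * (n : ℝ) ^ 2 := by
    rw [sum_comm]
    refine sum_le_sum fun I hI => ?_
    have hI' := hind I (by simpa [hS] using hI)
    rw [sum_add_distrib]
    have e1 : ∑ v : V, (if v ∈ I then (n : ℝ) else 0) = #I * n := by
      rw [← sum_filter, filter_mem_eq_inter, univ_inter, sum_const, nsmul_eq_mul]
    have e2 : ∑ v : V, #(G.neighborFinset v ∩ I) = ∑ u ∈ I, G.degree u := by
      have : ∀ v, #(G.neighborFinset v ∩ I) = ∑ u ∈ I, if G.Adj v u then 1 else 0 := by
        intro v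
        rw [inter_comm, ← filter_mem_eq_inter, card_filter]
        simp
      simp_rw [this]
      rw [sum_comm]
      refine sum_congr rfl fun u _ => ?_
      rw [← card_filter, ← card_neighborFinset_eq_degree]
      congr 1
      ext; simp [adj_comm]
    have e3 : ∑ v : V, (#(G.neighborFinset v ∩ I) : ℝ) ≤ #I * n := by
      have : ∑ u ∈ I, G.degree u ≤ #I * n := by
        simpa using sum_le_card_nsmul I (fun u => G.degree u) n fun u _ => hdeg u
      rw [← e2] at this
      exact_mod_cast this
    have e4 : (#I : ℝ) * n ≤ n * n := by gcongr
    rw [e1]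
    linarith
  have h3 := h1.trans h2
  simp only [sum_const, card_univ, nsmul_eq_mul] at h3
  have hpos : (0 : ℝ) < #S := by exact_mod_cast hne.card_pos
  have h4 : (#S : ℝ) * (Fintype.card V * Real.log n) ≤ #S * (16 * n ^ 2) := by linarith
  exact le_of_mul_le_mul_left h4 hpos

end IndepSets

theorem exists_ramsey_graph_poly :
    ∀ᶠ n : ℕ in Filter.atTop, ∃ G : SimpleGraph (Fin (n ^ 5)),
      G.CliqueFree 22 ∧ Gᶜ.CliqueFree n := by
  classical
  have hlog : ∀ᶠ n : ℕ in Filter.atTop, Real.log n ≤ (1 / 40) * √n := by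
    have h := (isLittleO_log_rpow_atTop (r := 1 / 2) (by norm_num)).bound
      (show (0 : ℝ) < 1 / 40 by norm_num)
    have h2 := tendsto_natCast_atTop_atTop (R := ℝ) |>.eventually h
    filter_upwards [h2] with n hn
    rw [← Real.sqrt_eq_rpow, Real.norm_of_nonneg (Real.sqrt_nonneg _)] at hn
    exact (le_abs_self _).trans hn
  filter_upwards [hlog, Filter.eventually_ge_atTop 10000] with n hlogn hn
  have hn0 : (10000 : ℝ) ≤ n := by exact_mod_cast hn
  obtain ⟨y, hy⟩ : ∃ y : ℝ, y = √n := ⟨_, rfl⟩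
  rw [← hy] at hlogn
  have hyy : y * y = n := by rw [hy]; exact Real.mul_self_sqrt (by linarith)
  have hy0 : 0 ≤ y := by rw [hy]; exact Real.sqrt_nonneg _
  have hy100 : 100 ≤ y := by nlinarith
  obtain ⟨p, hp⟩ : ∃ p : ℝ, p = y⁻¹ := ⟨_, rfl⟩
  have hp0 : 0 ≤ p := by rw [hp]; positivity
  have hp1 : p ≤ 1 := by rw [hp]; exact inv_le_one_of_one_le₀ (by linarith)
  have hpn : p * n = y := by rw [hp, ← hyy]; field_simp
  let T : Finset (Fin (n ^ 5)) → Finset (Sym2 (Fin (n ^ 5))) := fun A =>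
    A.offDiag.image fun x => s(x.1, x.2)
  have hT : ∀ A, #(T A) = (#A).choose 2 := fun A => Sym2.card_image_offDiag A
  have hclique : bernoulliProb p (fun F => ∃ A ∈ (univ : Finset (Fin (n ^ 5))).powersetCard 22,
      T A ⊆ F) ≤ 1 / 4 := by
    refine (bernoulliProb_exists_le hp0 hp1 _ _).trans ?_
    have h1 : ∀ A ∈ (univ : Finset (Fin (n ^ 5))).powersetCard 22,
        bernoulliProb p (fun F => T A ⊆ F) ≤ p ^ 231 := by
      intro A hA
      have := bernoulliProb_subset_disjoint p (disjoint_empty_right (T A))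
      simp only [disjoint_empty_left, and_true, card_empty, pow_zero, mul_one, hT,
        (mem_powersetCard.1 hA).2] at this
      exact this.le
    refine (sum_le_sum h1).trans ?_
    rw [sum_const, card_powersetCard, card_univ, Fintype.card_fin, nsmul_eq_mul]
    have h2 : (((n ^ 5).choose 22 : ℕ) : ℝ) ≤ (n : ℝ) ^ 110 := by
      have := Nat.choose_le_pow (n ^ 5) 22
      rw [← pow_mul] at this
      exact_mod_cast this
    calc _ ≤ (n : ℝ) ^ 110 * p ^ 231 := mul_le_mul_of_nonneg_right h2 (pow_nonneg hp0 231)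
      _ = p ^ 11 := by
        rw [← hyy, hp, ← sq, ← pow_mul, inv_pow, inv_pow]
        field_simp
      _ ≤ p := pow_le_of_le_one hp0 hp1 (by norm_num)
      _ ≤ 1 / 4 := by
        rw [hp, inv_le_comm₀ (by linarith) (by norm_num)]
        linarith
  have hindep : bernoulliProb p (fun F => ∃ A ∈ (univ : Finset (Fin (n ^ 5))).powersetCard n,
      Disjoint (T A) F) ≤ 1 / 4 := by
    refine (bernoulliProb_exists_le hp0 hp1 _ _).trans ?_
    have h1 : ∀ A ∈ (univ : Finset (Fin (n ^ 5))).powersetCard n,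
        bernoulliProb p (fun F => Disjoint (T A) F) ≤ Real.exp (-(y * (n - 1) / 2)) := by
      intro A hA
      have := bernoulliProb_subset_disjoint p (disjoint_empty_left (T A))
      simp only [empty_subset, true_and, card_empty, pow_zero, one_mul, hT,
        (mem_powersetCard.1 hA).2] at this
      rw [this]
      have h2 : 1 - p ≤ Real.exp (-p) := by linarith [Real.add_one_le_exp (-p)]
      calc (1 - p) ^ n.choose 2 ≤ Real.exp (-p) ^ n.choose 2 :=
            pow_le_pow_left₀ (by linarith) h2 _
        _ = Real.exp (-(y * (n - 1) / 2)) := by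
          rw [← Real.exp_nat_mul, Nat.cast_choose_two, ← hpn]
          ring_nf
    refine (sum_le_sum h1).trans ?_
    rw [sum_const, card_powersetCard, card_univ, Fintype.card_fin, nsmul_eq_mul]
    have h2 : (((n ^ 5).choose n : ℕ) : ℝ) ≤ Real.exp (n * (5 * Real.log n)) := by
      have := Nat.choose_le_pow (n ^ 5) n
      have h3 : Real.exp (n * (5 * Real.log n)) = ((n : ℝ) ^ 5) ^ n := by
        rw [Real.exp_nat_mul]
        congr 1
        have := Real.exp_nat_mul (Real.log n) 5
        push_cast at this
        rw [this, Real.exp_log (by linarith)]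
      rw [h3]
      exact_mod_cast this
    calc _ ≤ Real.exp (n * (5 * Real.log n)) * Real.exp (-(y * (n - 1) / 2)) := by gcongr
      _ = Real.exp (n * (5 * Real.log n) + -(y * (n - 1) / 2)) := (Real.exp_add _ _).symm
      _ ≤ Real.exp (-4) := by
        apply Real.exp_le_exp.2
        have : (n : ℝ) * (5 * Real.log n) ≤ n * (y / 8) := by gcongr; linarith
        nlinarith
      _ ≤ 1 / 4 := by
        rw [Real.exp_neg, inv_le_comm₀ (Real.exp_pos _) (by norm_num)]
        linarith [Real.add_one_le_exp (4 : ℝ)]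
  have hor := bernoulliProb_or_le hp0 hp1
    (fun F => ∃ A ∈ (univ : Finset (Fin (n ^ 5))).powersetCard 22, T A ⊆ F)
    (fun F => ∃ A ∈ (univ : Finset (Fin (n ^ 5))).powersetCard n, Disjoint (T A) F)
  obtain ⟨F, hF⟩ := exists_not_of_bernoulliProb_lt_one (hor.trans_lt (by linarith))
  rw [not_or] at hF
  refine ⟨SimpleGraph.fromEdgeSet (F : Set (Sym2 (Fin (n ^ 5)))), fun A hA => hF.1
    ⟨A, by simp [mem_powersetCard, hA.card_eq], fun e he => ?_⟩, fun A hA => hF.2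
    ⟨A, by simp [mem_powersetCard, hA.card_eq], disjoint_left.2 fun e he heF => ?_⟩⟩
  · obtain ⟨⟨a, b⟩, hab, rfl⟩ := mem_image.1 he
    rw [mem_offDiag] at hab
    have := hA.isClique hab.1 hab.2.1 hab.2.2
    rw [fromEdgeSet_adj] at this
    exact this.1
  · obtain ⟨⟨a, b⟩, hab, rfl⟩ := mem_image.1 he
    rw [mem_offDiag] at hab
    have := hA.isClique hab.1 hab.2.1 hab.2.2
    rw [compl_adj, fromEdgeSet_adj] at this
    exact this.2 ⟨heF, hab.2.2⟩

theorem exists_isNClique_or_compl (k n : ℕ) : ∃ N : ℕ, ∀ {V : Type} (G : SimpleGraph V)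
    (S : Finset V), N ≤ #S → (∃ s ⊆ S, G.IsNClique k s) ∨ (∃ s ⊆ S, Gᶜ.IsNClique n s) := by
  classical
  induction k generalizing n with
  | zero => exact ⟨0, fun G S _ => Or.inl ⟨∅, empty_subset _, by simp⟩⟩
  | succ k ihk =>
    induction n with
    | zero => exact ⟨0, fun G S _ => Or.inr ⟨∅, empty_subset _, by simp⟩⟩
    | succ n ihn =>
      obtain ⟨N₁, h₁⟩ := ihk (n + 1)
      obtain ⟨N₂, h₂⟩ := ihn
      refine ⟨N₁ + N₂ + 1, fun {V} G S hS => ?_⟩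
      obtain ⟨v, hv⟩ : S.Nonempty := card_pos.1 (by omega)
      have hsum := card_filter_add_card_filter_not (s := S.erase v) (fun u => G.Adj v u)
      rw [card_erase_of_mem hv] at hsum
      rcases le_or_gt N₁ #{u ∈ S.erase v | G.Adj v u} with h | h
      · rcases h₁ G _ h with ⟨s, hs, hc⟩ | ⟨s, hs, hc⟩
        · exact Or.inl ⟨insert v s, insert_subset hv (hs.trans ((filter_subset _ _).trans (erase_subset _ _))),
            hc.insert fun b hb => (mem_filter.1 (hs hb)).2⟩
        · exact Or.inr ⟨s, hs.trans ((filter_subset _ _).trans (erase_subset _ _)), hc⟩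
      · rcases h₂ G {u ∈ S.erase v | ¬ G.Adj v u} (by omega) with ⟨s, hs, hc⟩ | ⟨s, hs, hc⟩
        · exact Or.inl ⟨s, hs.trans ((filter_subset _ _).trans (erase_subset _ _)), hc⟩
        · exact Or.inr ⟨insert v s, insert_subset hv (hs.trans ((filter_subset _ _).trans (erase_subset _ _))),
            hc.insert fun b hb => (compl_adj _ _ _).2
              ⟨(ne_of_mem_erase (mem_filter.1 (hs hb)).1).symm, (mem_filter.1 (hs hb)).2⟩⟩

theorem ramsey_spec (k n : ℕ) : 0 < ramsey k n ∧ ∀ G : SimpleGraph (Fin (ramsey k n)),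
    (∃ s : Finset (Fin (ramsey k n)), G.IsNClique k s) ∨
      (∃ s : Finset (Fin (ramsey k n)), Gᶜ.IsNClique n s) := by
  obtain ⟨N, hN⟩ := exists_isNClique_or_compl k n
  refine Nat.sInf_mem (s := {N : ℕ | 0 < N ∧ ∀ G : SimpleGraph (Fin N),
    (∃ s : Finset (Fin N), G.IsNClique k s) ∨ (∃ s : Finset (Fin N), Gᶜ.IsNClique n s)})
    ⟨N + 1, Nat.succ_pos _, fun G => ?_⟩
  rcases hN G univ (by simp) with ⟨s, -, hs⟩ | ⟨s, -, hs⟩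
  · exact Or.inl ⟨s, hs⟩
  · exact Or.inr ⟨s, hs⟩

theorem card_lt_ramsey {V : Type*} [Fintype V] {G : SimpleGraph V} {k n : ℕ}
    (hk : G.CliqueFree k) (hn : Gᶜ.CliqueFree n) : Fintype.card V < ramsey k n := by
  by_contra! h
  have hcard : Fintype.card (Fin (ramsey k n)) ≤ Fintype.card V := by simpa using h
  obtain ⟨f⟩ := Function.Embedding.nonempty_of_card_le hcard
  rcases (ramsey_spec k n).2 (G.comap f) with ⟨s, hs⟩ | ⟨s, hs⟩
  · exact (hk.comap ⟨(SimpleGraph.Embedding.comap f G).toCopy⟩) s hs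
  · refine hn (s.map f) ⟨?_, by rw [card_map, hs.card_eq]⟩
    intro a ha b hb hab
    obtain ⟨u, hu, rfl⟩ := mem_map.1 (mem_coe.1 ha)
    obtain ⟨v, hv, rfl⟩ := mem_map.1 (mem_coe.1 hb)
    have huv := hs.isClique hu hv fun h => hab (by rw [h])
    exact (compl_adj _ _ _).2 ⟨hab, ((compl_adj _ _ _).1 huv).2⟩

theorem exists_cliqueFree_ramsey {k n : ℕ} (hk : 1 ≤ k) (hn : 1 ≤ n) :
    ∃ G : SimpleGraph (Fin (ramsey k n - 1)), G.CliqueFree k ∧ Gᶜ.CliqueFree n := by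
  have hpos := (ramsey_spec k n).1
  rcases Nat.eq_zero_or_pos (ramsey k n - 1) with h0 | h0
  · have hs : ∀ s : Finset (Fin (ramsey k n - 1)), #s = 0 := fun s => by
      have := card_le_univ s
      rw [Fintype.card_fin] at this
      omega
    exact ⟨⊥, fun s h => by have := hs s; have := h.card_eq; omega,
      fun s h => by have := hs s; have := h.card_eq; omega⟩
  · have hlt : ramsey k n - 1 < ramsey k n := by omega
    have := Nat.notMem_of_lt_sInf hlt
    simp only [Set.mem_ofPred_eq, not_and, not_forall, not_or, not_exists] at this
    obtain ⟨G, h1, h2⟩ := this h0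
    exact ⟨G, fun s => h1 s, fun s => h2 s⟩

theorem ramsey_mono {k n k' n' : ℕ} (hk : 1 ≤ k) (hn : 1 ≤ n) (hkk : k ≤ k') (hnn : n ≤ n') :
    ramsey k n ≤ ramsey k' n' := by
  obtain ⟨G, h1, h2⟩ := exists_cliqueFree_ramsey hk hn
  have := card_lt_ramsey (h1.mono hkk) (h2.mono hnn)
  rw [Fintype.card_fin] at this
  omega

theorem ramsey_three_lt_succ {n : ℕ} (hn : 1 ≤ n) : ramsey 3 n < ramsey 3 (n + 1) := by
  classical
  obtain ⟨G, h1, h2⟩ := exists_cliqueFree_ramsey (k := 3) (by norm_num) hn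
  have hc3 : (G.map Function.Embedding.some).CliqueFree 3 := by
    intro s hs
    obtain ⟨a, b, c, hab, hac, hbc, -⟩ := is3Clique_iff.1 hs
    obtain ⟨-, u, v, huv, rfl, rfl⟩ := hab
    obtain ⟨-, u', w, huw, hu, rfl⟩ := hac
    obtain ⟨-, v', w', hvw, hv, hw⟩ := hbc
    have e1 := Function.Embedding.some.injective hu
    have e2 := Function.Embedding.some.injective hv
    have e3 := Function.Embedding.some.injective hw
    subst e1 e2 e3
    exact h1 {u', v', w'} (is3Clique_iff.2 ⟨_, _, _, huv, huw, hvw, rfl⟩)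
  have hcn : (G.map Function.Embedding.some)ᶜ.CliqueFree (n + 1) := by
    intro s hs
    have hle : n ≤ #(eraseNone s) := by
      have h3 := card_map Function.Embedding.some (s := eraseNone s)
      rw [map_some_eraseNone] at h3
      have := pred_card_le_card_erase (s := s) (a := none)
      have := hs.card_eq
      omega
    obtain ⟨t, ht, htn⟩ := exists_subset_card_eq hle
    refine h2 t ⟨fun a ha b hb hab => ?_, htn⟩
    have := hs.isClique (mem_eraseNone.1 (ht ha)) (mem_eraseNone.1 (ht hb)) (by simpa using hab)
    rw [compl_adj] at this ⊢
    refine ⟨hab, fun h => this.2 ?_⟩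
    exact (SimpleGraph.map_adj_apply (f := Function.Embedding.some)).2 h
  have := card_lt_ramsey hc3 hcn
  have hpos := (ramsey_spec 3 n).1
  rw [Fintype.card_option, Fintype.card_fin] at this
  omega

theorem ramsey_three_mul_log_le {n : ℕ} (hn : 1 ≤ n) :
    ((ramsey 3 n : ℝ) - 1) * Real.log n ≤ 16 * n ^ 2 := by
  classical
  obtain ⟨G, h1, h2⟩ := exists_cliqueFree_ramsey (k := 3) (by norm_num) hn
  have := card_mul_log_le h1 hn h2
  rw [Fintype.card_fin, Nat.cast_sub (ramsey_spec 3 n).1] at this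
  exact_mod_cast this

theorem le_ramsey_three : ∃ c : ℝ, 0 < c ∧ ∀ᶠ n : ℕ in Filter.atTop,
    c * n ^ 2 ≤ ramsey 3 n * Real.log n := by
  obtain ⟨A, hA⟩ : ∃ A : ℝ, A = 3200000 := ⟨_, rfl⟩
  obtain ⟨W, hW⟩ : ∃ W : ℝ, W = 10 ^ 7 + 1 := ⟨_, rfl⟩
  have hA1 : 1 ≤ A := by rw [hA]; norm_num
  have hW1 : 1 ≤ W := by rw [hW]; norm_num
  refine ⟨(A ^ 2 * 2 ^ 101)⁻¹, by positivity, ?_⟩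
  have hev := tendsto_natCast_atTop_atTop (R := ℝ) |>.eventually
    (Filter.eventually_ge_atTop ((A * W ^ 50) ^ 2))
  filter_upwards [hev, Filter.eventually_ge_atTop 3] with n hn hn3
  have hn3' : (3 : ℝ) ≤ n := by exact_mod_cast hn3
  have hn0 : (0 : ℝ) < n := by linarith
  obtain ⟨y, hy⟩ : ∃ y : ℝ, y = √(Real.log n) := ⟨_, rfl⟩
  have hlog1 : 1 ≤ Real.log n := by
    rw [Real.le_log_iff_exp_le hn0]; linarith [Real.exp_one_lt_d9]
  have hy1 : 1 ≤ y := by rw [hy]; exact Real.one_le_sqrt.2 hlog1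
  have hyy : y * y = Real.log n := by rw [hy]; exact Real.mul_self_sqrt (by linarith)
  have hsq : A * W ^ 50 ≤ √n := by
    rw [Real.le_sqrt (by positivity) hn0.le]; exact hn
  have hysq : y ≤ √n := by rw [hy]; exact Real.sqrt_le_sqrt (Real.log_le_self hn0.le)
  have hnn : √n * √n = n := Real.mul_self_sqrt hn0.le
  obtain ⟨r, hr⟩ : ∃ r : ℝ, r = n / (A * y) := ⟨_, rfl⟩
  have hrA : r * (A * y) = n := by rw [hr]; field_simp
  have hr0 : 0 ≤ r := by rw [hr]; positivity
  have hrW : W ^ 50 ≤ r := by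
    rw [hr, le_div_iff₀ (by positivity)]
    calc W ^ 50 * (A * y) = (A * W ^ 50) * y := by ring
      _ ≤ √n * √n := by gcongr
      _ = n := hnn
  obtain ⟨w, hw⟩ : ∃ w : ℝ, w = r ^ ((50 : ℝ)⁻¹) := ⟨_, rfl⟩
  have hw50 : w ^ 50 = r := by
    rw [hw]
    have := Real.rpow_inv_natCast_pow hr0 (n := 50) (by norm_num)
    exact_mod_cast this
  have hw0 : 0 ≤ w := by rw [hw]; positivity
  have hWw : W ≤ w := by
    refine le_of_pow_le_pow_left₀ (n := 50) (by norm_num) hw0 ?_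
    rw [hw50]; exact hrW
  obtain ⟨z, hz⟩ : ∃ z : ℕ, z = ⌊w⌋₊ := ⟨_, rfl⟩
  have hzw : (z : ℝ) ≤ w := by rw [hz]; exact Nat.floor_le hw0
  have hwz : w < z + 1 := by rw [hz]; exact Nat.lt_floor_add_one w
  have hz7 : 10 ^ 7 ≤ z := by
    have : (10 : ℝ) ^ 7 ≤ z := by linarith
    exact_mod_cast this
  have hz1 : (1 : ℝ) ≤ z := by exact_mod_cast le_trans (by norm_num) hz7
  have hzr : (z : ℝ) ^ 50 ≤ r := by rw [← hw50]; gcongr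
  have hzn : (z : ℝ) ≤ n := by
    calc (z : ℝ) ≤ z ^ 50 := le_self_pow₀ hz1 (by norm_num)
      _ ≤ r := hzr
      _ ≤ r * (A * y) := le_mul_of_one_le_right hr0 (one_le_mul_of_one_le_of_one_le hA1 hy1)
      _ = n := hrA
  obtain ⟨V, _, G, hV, h1, h2⟩ := exists_triangleFree_graph hz7
  have hsz : √(Real.log z) ≤ y := by
    rw [hy]; exact Real.sqrt_le_sqrt (Real.log_le_log (by linarith) hzn)
  have hle : 8 * ⌈200000 * √(Real.log z) * (z : ℝ) ^ 50⌉₊ ≤ n := by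
    have e1 : 200000 * √(Real.log z) * (z : ℝ) ^ 50 ≤ 200000 * y * r := by gcongr
    have e2 := Nat.ceil_lt_add_one (a := 200000 * √(Real.log z) * (z : ℝ) ^ 50) (by positivity)
    have e3 : 1 ≤ y * r := one_le_mul_of_one_le_of_one_le hy1 ((one_le_pow₀ hW1).trans hrW)
    have e4 : 3200000 * (y * r) = n := by rw [← hrA, hA]; ring
    have : (8 : ℝ) * ⌈200000 * √(Real.log z) * (z : ℝ) ^ 50⌉₊ ≤ n := by linarith
    exact_mod_cast this
  have hlt := card_lt_ramsey h1 (h2.mono hle)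
  have hlt' : (Fintype.card V : ℝ) ≤ ramsey 3 n := by exact_mod_cast hlt.le
  have hwz2 : w ≤ 2 * z := by linarith
  have hr2 : r ^ 2 ≤ 2 ^ 100 * (z : ℝ) ^ 100 := by
    rw [← hw50, ← pow_mul, ← mul_pow]; gcongr
  have hfin : (2 : ℝ) ^ 100 * z ^ 100 ≤ 2 ^ 101 * ramsey 3 n := by
    have : (2 : ℝ) ^ 101 = 2 ^ 100 * 2 := pow_succ _ _
    rw [this, mul_assoc]
    have : (z : ℝ) ^ 100 ≤ 2 * ramsey 3 n := by linarith
    gcongr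
  rw [inv_mul_le_iff₀ (by positivity), ← hyy]
  calc (n : ℝ) ^ 2 = r ^ 2 * (A ^ 2 * (y * y)) := by rw [← hrA]; ring
    _ ≤ (2 ^ 101 * ramsey 3 n) * (A ^ 2 * (y * y)) :=
      mul_le_mul_of_nonneg_right (hr2.trans hfin) (by positivity)
    _ = _ := by ring

theorem ramseySet_finite (x : ℝ) : (RamseySet x).Finite :=
  (Set.finite_Iic ⌊x⌋₊).subset fun _ hm => Nat.le_floor hm.2

theorem one_le_log_of_three_le {x : ℝ} (hx : 3 ≤ x) : 1 ≤ Real.log x := by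
  rw [Real.le_log_iff_exp_le (by linarith)]
  linarith [Real.exp_one_lt_d9]

theorem sqrt_le_sqrt_mul_log {x : ℝ} (hx : 3 ≤ x) : √x ≤ √(x * Real.log x) :=
  Real.sqrt_le_sqrt (le_mul_of_one_le_right (by linarith) (one_le_log_of_three_le hx))

theorem le_ramseyCount {x : ℝ} (hx : 160000 ≤ x) :
    1 / 32 * √(x * Real.log x) ≤ ramseyCount x := by
  have hlog := one_le_log_of_three_le (x := x) (by linarith)
  have hS := sqrt_le_sqrt_mul_log (x := x) (by linarith)
  obtain ⟨S, hSdef⟩ : ∃ S : ℝ, S = √(x * Real.log x) := ⟨_, rfl⟩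
  have hSS : S * S = x * Real.log x := by
    rw [hSdef]; exact Real.mul_self_sqrt (by positivity)
  rw [← hSdef] at hS ⊢
  obtain ⟨t, ht⟩ : ∃ t : ℝ, t = √√x := ⟨_, rfl⟩
  have htt : t * t = √x := by rw [ht]; exact Real.mul_self_sqrt (Real.sqrt_nonneg _)
  have ht20 : 20 ≤ t := by
    rw [ht, Real.le_sqrt (by norm_num) (Real.sqrt_nonneg _),
      Real.le_sqrt (by norm_num) (by linarith)]
    linarith
  have hlogt : Real.log t = Real.log x / 4 := by
    rw [ht, Real.log_sqrt (Real.sqrt_nonneg _), Real.log_sqrt (by linarith)]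
    ring
  obtain ⟨M, hM⟩ : ∃ M : ℕ, M = ⌊S / 16⌋₊ := ⟨_, rfl⟩
  have hS0 : 400 ≤ S := by nlinarith
  have hM1 : (M : ℝ) ≤ S / 16 := by rw [hM]; exact Nat.floor_le (by positivity)
  have hM2 : S / 16 < M + 1 := by rw [hM]; exact Nat.lt_floor_add_one _
  have htM : t ≤ M := by nlinarith
  have hM20 : (20 : ℝ) ≤ M := ht20.trans htM
  have hMn : 20 ≤ M := by exact_mod_cast hM20
  have hlogM : Real.log x / 4 ≤ Real.log M := by
    rw [← hlogt]; exact Real.log_le_log (by linarith) htM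
  have hrM : (ramsey 3 M : ℝ) ≤ x := by
    by_contra! hcon
    have h1 := ramsey_three_mul_log_le (n := M) (by omega)
    have h2 : (x - 1) * (Real.log x / 4) ≤ ((ramsey 3 M : ℝ) - 1) * Real.log M :=
      mul_le_mul (by linarith) hlogM (by positivity) (by linarith)
    have h3 : (M : ℝ) ^ 2 ≤ S * S / 256 := by nlinarith
    nlinarith
  have hmono : StrictMonoOn (ramsey 3) (Set.Ici 1) := by
    refine strictMonoOn_of_lt_succ Set.ordConnected_Ici fun n _ hn _ => ?_
    exact ramsey_three_lt_succ hn
  have hsub : (((Icc 3 M).image (ramsey 3) : Finset ℕ) : Set ℕ) ⊆ RamseySet x := by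
    intro m hm
    obtain ⟨n, hn, rfl⟩ := mem_image.1 (mem_coe.1 hm)
    rw [mem_Icc] at hn
    refine ⟨⟨3, n, le_rfl, hn.1, rfl⟩, le_trans ?_ hrM⟩
    exact_mod_cast ramsey_mono (by norm_num) (by omega) le_rfl hn.2
  have hcard := Set.ncard_le_ncard hsub (ramseySet_finite x)
  rw [Set.ncard_coe_finset, card_image_of_injOn, Nat.card_Icc] at hcard
  · have : (M : ℝ) + 1 ≤ ramseyCount x + 3 := by
      have : M + 1 ≤ (RamseySet x).ncard + 3 := by omega
      exact_mod_cast this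
    linarith
  · exact hmono.injOn.mono fun n hn => by
      have := (mem_Icc.1 (mem_coe.1 hn)).1
      exact Set.mem_Ici.2 (by omega)

theorem le_of_ramsey_three_le : ∃ B : ℝ, 0 < B ∧ ∀ᶠ x : ℝ in Filter.atTop,
    ∀ n : ℕ, (ramsey 3 n : ℝ) ≤ x → (n : ℝ) ≤ B * √(x * Real.log x) := by
  obtain ⟨c, hc, hev⟩ := le_ramsey_three
  obtain ⟨n₀, hn₀⟩ := Filter.eventually_atTop.1 hev
  refine ⟨√(2 / c) + 1, by positivity, ?_⟩
  filter_upwards [Filter.eventually_ge_atTop (max 3 (max (1 / c) ((n₀ : ℝ) ^ 2)))] with x hx n hn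
  simp only [max_le_iff] at hx
  obtain ⟨hx3, hxc, hxn⟩ := hx
  have hlog := one_le_log_of_three_le hx3
  have hS := sqrt_le_sqrt_mul_log hx3
  rcases le_or_gt n₀ n with h | h
  · rcases Nat.eq_zero_or_pos n with rfl | hpos
    · simp only [Nat.cast_zero]; positivity
    have hnR : (0 : ℝ) < n := by exact_mod_cast hpos
    have hn1 : (1 : ℝ) ≤ n := by exact_mod_cast hpos
    have h1 : c * (n : ℝ) ^ 2 ≤ x * Real.log n :=
      (hn₀ n h).trans (mul_le_mul_of_nonneg_right hn (Real.log_nonneg hn1))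
    have h2 : c * (n : ℝ) ≤ x := by
      have : c * (n : ℝ) ^ 2 ≤ x * n :=
        h1.trans (mul_le_mul_of_nonneg_left (Real.log_le_self hnR.le) (by linarith))
      nlinarith
    have h3 : (n : ℝ) ≤ x ^ 2 := by
      have : (n : ℝ) ≤ 1 / c * x := by
        rw [one_div, ← div_eq_inv_mul, le_div_iff₀ hc]; linarith
      nlinarith
    have h4 : Real.log n ≤ 2 * Real.log x := by
      have := Real.log_le_log hnR h3
      rwa [Real.log_pow] at this
    have h5 : (n : ℝ) ≤ √(2 / c) * √(x * Real.log x) := by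
      rw [← Real.sqrt_mul (by positivity)]
      refine Real.le_sqrt_of_sq_le ?_
      rw [div_mul_eq_mul_div, le_div_iff₀ hc]
      nlinarith
    linarith [Real.sqrt_nonneg (x * Real.log x)]
  · have h1 : (n₀ : ℝ) ≤ √x := Real.le_sqrt_of_sq_le hxn
    have h2 : (n : ℝ) ≤ n₀ := by exact_mod_cast h.le
    have : 0 ≤ √(2 / c) * √(x * Real.log x) := by positivity
    linarith

theorem le_of_ramsey_le : ∀ᶠ x : ℝ in Filter.atTop, ∀ k n : ℕ, 22 ≤ k →
    (ramsey k n : ℝ) ≤ x → (n : ℝ) ≤ √√x := by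
  obtain ⟨n₀, hn₀⟩ := Filter.eventually_atTop.1 exists_ramsey_graph_poly
  filter_upwards [Filter.eventually_ge_atTop (max 3 ((n₀ : ℝ) ^ 4))] with x hx k n hk hr
  simp only [max_le_iff] at hx
  refine Real.le_sqrt_of_sq_le (Real.le_sqrt_of_sq_le ?_)
  rw [← pow_mul]
  rcases le_or_gt n₀ n with h | h
  · rcases Nat.eq_zero_or_pos n with rfl | hpos
    · simp only [Nat.cast_zero]; norm_num; linarith
    obtain ⟨G, h1, h2⟩ := hn₀ n h
    have h3 := card_lt_ramsey (h1.mono hk) h2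
    rw [Fintype.card_fin] at h3
    have h4 : n ^ 4 ≤ ramsey k n := (Nat.pow_le_pow_right hpos (by norm_num)).trans h3.le
    have : (n : ℝ) ^ 4 ≤ ramsey k n := by exact_mod_cast h4
    exact this.trans hr
  · refine le_trans ?_ hx.2
    have : (n : ℝ) ≤ n₀ := by exact_mod_cast h.le
    simpa using pow_le_pow_left₀ (Nat.cast_nonneg n) this 4

theorem ramseyCount_le : ∃ b : ℝ, 0 < b ∧ ∀ᶠ x : ℝ in Filter.atTop,
    ramseyCount x ≤ b * √(x * Real.log x) := by
  obtain ⟨B, hB, hev⟩ := le_of_ramsey_three_le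
  refine ⟨22 * B + 26, by positivity, ?_⟩
  filter_upwards [hev, le_of_ramsey_le, Filter.eventually_ge_atTop 3] with x h3 h22 hx
  have hS := sqrt_le_sqrt_mul_log hx
  have hx1 : 1 ≤ √x := Real.one_le_sqrt.2 (by linarith)
  have ht1 : 1 ≤ √√x := Real.one_le_sqrt.2 hx1
  have htt : √√x * √√x = √x := Real.mul_self_sqrt (Real.sqrt_nonneg _)
  have hsub : RamseySet x ⊆ ((((range 22 ×ˢ range (⌊B * √(x * Real.log x)⌋₊ + 1)) ∪
      (range (⌊√√x⌋₊ + 1) ×ˢ range (⌊√√x⌋₊ + 1))).image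
      fun p => ramsey p.1 p.2 : Finset ℕ) : Set ℕ) := by
    rintro m ⟨⟨k, n, hk, hkn, rfl⟩, hm⟩
    rw [mem_coe, mem_image]
    refine ⟨(k, n), ?_, rfl⟩
    rw [mem_union, mem_product, mem_product]
    simp only [mem_range, Nat.lt_succ_iff]
    rcases lt_or_ge k 22 with hk22 | hk22
    · refine Or.inl ⟨by omega, Nat.le_floor (h3 n (le_trans ?_ hm))⟩
      exact_mod_cast ramsey_mono (by norm_num) (by omega) hk le_rfl
    · have := Nat.le_floor (h22 k n hk22 hm)
      exact Or.inr ⟨hkn.trans this, this⟩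
  have hcard := (Set.ncard_le_ncard hsub (Finset.finite_toSet _))
  rw [Set.ncard_coe_finset] at hcard
  have hcard' := hcard.trans (card_image_le.trans (card_union_le _ _))
  simp only [card_product, card_range] at hcard'
  have hR : (ramseyCount x : ℝ) ≤ 22 * ((⌊B * √(x * Real.log x)⌋₊ : ℝ) + 1) +
      ((⌊√√x⌋₊ : ℝ) + 1) * ((⌊√√x⌋₊ : ℝ) + 1) := by exact_mod_cast hcard'
  have e1 : (⌊B * √(x * Real.log x)⌋₊ : ℝ) ≤ B * √(x * Real.log x) :=
    Nat.floor_le (by positivity)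
  have e2 : (⌊√√x⌋₊ : ℝ) ≤ √√x := Nat.floor_le (by positivity)
  have e3 : (0 : ℝ) ≤ ⌊√√x⌋₊ := Nat.cast_nonneg _
  have e4 : ((⌊√√x⌋₊ : ℝ) + 1) * ((⌊√√x⌋₊ : ℝ) + 1) ≤ (2 * √√x) * (2 * √√x) :=
    mul_le_mul (by linarith) (by linarith) (by linarith) (by linarith)
  nlinarith

/-- `r(x) = Θ(√(x ln x))`. -/
theorem ramseyCount_isTheta_sqrt_mul_log :
    ∃ a b x₀ : ℝ, 0 < a ∧ 0 < b ∧ 0 < x₀ ∧ ∀ x : ℝ, x₀ ≤ x →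
      a * Real.sqrt (x * Real.log x) ≤ (ramseyCount x : ℝ) ∧
      (ramseyCount x : ℝ) ≤ b * Real.sqrt (x * Real.log x) := by
  obtain ⟨b, hb, hev⟩ := ramseyCount_le
  obtain ⟨x₁, hx₁⟩ := Filter.eventually_atTop.1 hev
  refine ⟨1 / 32, b, max 160000 x₁, by norm_num, hb, lt_max_of_lt_left (by norm_num),
    fun x hx => ⟨le_ramseyCount ((le_max_left _ _).trans hx), hx₁ x ((le_max_right _ _).trans hx)⟩⟩
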